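/- Let I ⊆ R be an S_n-invariant monomial ideal and μ = (d_1^{p_1},…,d_s^{p_s},0^{p_{s+1}}) ∈ P_n with d_1 > ⋯ > d_s > 0. Then for every i ≥ 0, dim_k Tor_i(R/I,k)_{⟨μ⟩} = Σ_{0 ≤ c ≤ p(μ)} D(c) · dim_k H̃_{s−i−1+|c|}(Γ^{μ,c}(I); k), where D(c) = (n! / (p_1!⋯p_s!·p_{s+1}!)) · Π_{k=1}^s C(p_k−1, c_k) is the dimension of the induced S_n-representation Ind_{S_{p_1}×⋯×S_{p_s}×S_{p_{s+1}}}^{S_n}(S^{(p_1−c_1,1^{c_1})} ⊠ ⋯ ⊠ S^{(p_s−c_s,1^{c_s})} ⊠ S^{(p_{s+1})}) of tensor products of hook Specht modules. -/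

import Mathlib

open scoped BigOperators

noncomputable section
open Classical

/-! ## Generic (labeled) simplicial chain complexes and reduced homology over a field -/

section Homology

variable (K : Type) [Field K] {α : Type}

/-- Index type for chains: elements of `S` whose face (second component) has `j` elements. -/
def ChainIdx (S : Set (α × Finset ℕ)) (j : ℕ) : Type :=
  {q : α × Finset ℕ // q ∈ S ∧ q.2.card = j}

/-- The boundary of a basis element, with the usual simplicial signs. -/
noncomputable def bdElt (S : Set (α × Finset ℕ)) (j : ℕ) (q : ChainIdx S (j + 1)) :
    ChainIdx S j →₀ K :=
  ∑ v ∈ q.1.2,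
    if h : (q.1.1, q.1.2.erase v) ∈ S ∧ (q.1.2.erase v).card = j then
      ((-1 : K) ^ (q.1.2.filter (fun u => u ≤ v)).card) •
        Finsupp.single (⟨(q.1.1, q.1.2.erase v), h⟩ : ChainIdx S j) (1 : K)
    else 0

/-- The simplicial boundary map. -/
noncomputable def bd (S : Set (α × Finset ℕ)) (j : ℕ) :
    (ChainIdx S (j + 1) →₀ K) →ₗ[K] (ChainIdx S j →₀ K) :=
  Finsupp.linearCombination K (bdElt K S j)

/-- Cycles in homological degree `j` (chains are indexed by the cardinality of faces;
degree `j` corresponds to reduced topological degree `j - 1`). -/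
noncomputable def cycles (S : Set (α × Finset ℕ)) : (j : ℕ) → Submodule K (ChainIdx S j →₀ K)
  | 0 => ⊤
  | (i + 1) => LinearMap.ker (bd K S i)

/-- `rhd K S j` is the dimension of the reduced homology group `H̃_{j-1}` of the complex `S`
(the chain groups being finite dimensional, this is `dim` cycles `- dim` boundaries). -/
noncomputable def rhd (S : Set (α × Finset ℕ)) (j : ℕ) : ℕ :=
  Module.finrank K (cycles K S j) -
    Module.finrank K (LinearMap.range (bd K S j) ⊓ cycles K S j : Submodule K _)

/-- `hdim K S j = dim_K H̃_j(S; K)`, for `j : ℤ` (zero for `j ≤ -2`). -/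
noncomputable def hdim (S : Set (α × Finset ℕ)) (j : ℤ) : ℕ :=
  if 0 ≤ j + 1 then rhd K S (j + 1).toNat else 0

/-- View an unlabeled collection of faces as a labeled one (labels in `Unit`). -/
def lab (Δ : Set (Finset ℕ)) : Set (Unit × Finset ℕ) := {q | q.2 ∈ Δ}

/-- Dimension of reduced homology `H̃_{j-1}(Δ; K)` of a collection `Δ` of finite sets. -/
noncomputable def rhd0 (Δ : Set (Finset ℕ)) (j : ℕ) : ℕ := rhd K (lab Δ) j

/-- Dimension of reduced homology `H̃_j(Δ; K)`, `j : ℤ`. -/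
noncomputable def hdim0 (Δ : Set (Finset ℕ)) (j : ℤ) : ℕ := hdim K (lab Δ) j

end Homology

/-! ## Monomial ideals in `k[x_1, …, x_n]`, invariant under the symmetric group -/

section Poly

variable (K : Type) [Field K] (n : ℕ)

/-- The monomial `x^a` in `k[x_1, …, x_n]`. -/
noncomputable def mon (a : Fin n → ℕ) : MvPolynomial (Fin n) K :=
  MvPolynomial.monomial (Finsupp.equivFunOnFinite.symm a) 1

/-- A monomial ideal: an ideal generated by a set of monomials. -/
def IsMonomialIdeal (I : Ideal (MvPolynomial (Fin n) K)) : Prop :=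
  ∃ S : Set (Fin n → ℕ), I = Ideal.span (mon K n '' S)

/-- `I` is invariant under the action of `S_n` permuting the variables. -/
def IsSymmetricIdeal (I : Ideal (MvPolynomial (Fin n) K)) : Prop :=
  ∀ σ : Equiv.Perm (Fin n), Ideal.map (MvPolynomial.rename σ).toRingHom I = I

end Poly

/-! ## Partitions given by blocks `(d_1^{p_1}, …, d_s^{p_s}, 0^{p_{s+1}})` -/

section Blocks

/-- `cumsum p k = p 0 + ⋯ + p (k-1)`. -/
def cumsum (p : ℕ → ℕ) (k : ℕ) : ℕ := ∑ j ∈ Finset.range k, p j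

/-- The index of the block (among blocks `0, …, s`) containing position `i`,
for blocks of sizes `p 0, …, p (s-1)` followed by a final block. -/
def blkOf (p : ℕ → ℕ) (s i : ℕ) : ℕ :=
  ((Finset.range s).filter fun k => cumsum p (k + 1) ≤ i).card

/-- The partition `μ = (d_0^{p_0}, …, d_{s-1}^{p_{s-1}}, 0^{p_s})` (0-indexed blocks),
as a function of the position `i ∈ {0, …, n-1}` where `n = cumsum p (s+1)`. -/
def muOf (s : ℕ) (d p : ℕ → ℕ) (i : ℕ) : ℕ :=
  if blkOf p s i < s then d (blkOf p s i) else 0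

/-- The partition `μ ∖ c`, obtained from `μ` by replacing, for each `k`, the last `c k` of
the parts equal to `d k` by `d k - 1`. -/
def muMinus (s : ℕ) (d p c : ℕ → ℕ) (i : ℕ) : ℕ :=
  if blkOf p s i < s then
    (if p (blkOf p s i) - c (blkOf p s i) ≤ i - cumsum p (blkOf p s i) then
      d (blkOf p s i) - 1 else d (blkOf p s i))
  else 0

/-- Indicator vector of a finite set `F`. -/
def eF (F : Finset ℕ) (j : ℕ) : ℕ := if j ∈ F then 1 else 0

end Blocks

/-! ## The simplicial complexes `Δ^{μ,c}(I)` and `Γ^{μ,c}(I)` -/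

section Complexes

variable (K : Type) [Field K] (n : ℕ)

/-- The simplicial complex `Δ^{μ,c}(I) = {F ⊆ [s] : μ ∖ (c + e_F) ∈ P(I)}` (vertices are
`0, …, s-1`), for `μ = (d_0^{p_0}, …, d_{s-1}^{p_{s-1}}, 0^{p_s})` and `c ≤ p(μ)`. -/
def DeltaCx (I : Ideal (MvPolynomial (Fin n) K)) (s : ℕ) (d p c : ℕ → ℕ) :
    Set (Finset ℕ) :=
  {F | F ⊆ Finset.range s ∧
    mon K n (fun i => muMinus s d p (fun j => c j + eF F j) i.val) ∈ I}

/-- The Alexander dual complex `Γ^{μ,c}(I) = {F ⊆ [s] : μ ∖ (c + e_{[s]∖F}) ∈ O(I)}`. -/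
def GammaCx (I : Ideal (MvPolynomial (Fin n) K)) (s : ℕ) (d p c : ℕ → ℕ) :
    Set (Finset ℕ) :=
  {F | F ⊆ Finset.range s ∧
    mon K n (fun i => muMinus s d p
      (fun j => c j + (if j < s ∧ j ∉ F then 1 else 0)) i.val) ∉ I}

/-- `γ_i^{μ,c}(I) = dim_K H̃_{i-1}(Δ^{μ,c}(I); K)`. -/
noncomputable def gammaDim (I : Ideal (MvPolynomial (Fin n) K)) (s : ℕ) (d p c : ℕ → ℕ)
    (i : ℕ) : ℕ :=
  rhd0 K (DeltaCx K n I s d p c) i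

end Complexes

/-! ## Multigraded Tor via the Koszul complex

For a monomial ideal `I`, the multidegree-`a` strand of the Koszul complex `K_•(I)` is the
(shifted) reduced chain complex of the simplicial complex
`Δ_a^I = {F ⊆ [n] : a - e_F ≥ 0, x^{a - e_F} ∈ I}`, so that
`dim_K Tor_i(I, K)_a = dim_K H̃_{i-1}(Δ_a^I; K)`, and similarly for `R/I` with the
condition `x^{a-e_F} ∉ I`. -/

section Tor

variable (K : Type) [Field K] (n : ℕ)

/-- The Koszul simplicial complex of the ideal `I` in multidegree `a`. -/
def KosI (I : Ideal (MvPolynomial (Fin n) K)) (a : Fin n → ℕ) : Set (Finset ℕ) :=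
  {F | F ⊆ Finset.range n ∧ (∀ i : Fin n, (i : ℕ) ∈ F → 1 ≤ a i) ∧
    mon K n (fun i => a i - eF F i.val) ∈ I}

/-- The Koszul complex of `R/I` in multidegree `a`. -/
def KosQ (I : Ideal (MvPolynomial (Fin n) K)) (a : Fin n → ℕ) : Set (Finset ℕ) :=
  {F | F ⊆ Finset.range n ∧ (∀ i : Fin n, (i : ℕ) ∈ F → 1 ≤ a i) ∧
    mon K n (fun i => a i - eF F i.val) ∉ I}

/-- `dim_K Tor_i(I, K)_a`, for a monomial ideal `I` and a multidegree `a ∈ ℤ^n`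
(components with a negative coordinate vanish, so only `a ∈ ℕ^n` is needed). -/
noncomputable def torDim (I : Ideal (MvPolynomial (Fin n) K)) (i : ℕ) (a : Fin n → ℕ) : ℕ :=
  rhd0 K (KosI K n I a) i

/-- `dim_K Tor_i(R/I, K)_a` for a monomial ideal `I`. -/
noncomputable def torQDim (I : Ideal (MvPolynomial (Fin n) K)) (i : ℕ) (a : Fin n → ℕ) : ℕ :=
  rhd0 K (KosQ K n I a) i

/-- `dim_K Tor_i(I, K)_{⟨μ⟩}`: the sum of `dim_K Tor_i(I, K)_a` over all rearrangements `a`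
of the partition `μ`. -/
noncomputable def torDimSym (I : Ideal (MvPolynomial (Fin n) K)) (i : ℕ) (μ : Fin n → ℕ) : ℕ :=
  ∑ a ∈ Finset.image (fun σ : Equiv.Perm (Fin n) => μ ∘ σ) Finset.univ, torDim K n I i a

/-- `dim_K Tor_i(R/I, K)_{⟨μ⟩}`. -/
noncomputable def torQDimSym (I : Ideal (MvPolynomial (Fin n) K)) (i : ℕ) (μ : Fin n → ℕ) : ℕ :=
  ∑ a ∈ Finset.image (fun σ : Equiv.Perm (Fin n) => μ ∘ σ) Finset.univ, torQDim K n I i a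

end Tor

/-! ## Extended partitions in `P_n^∞` and the dual generators of an `S_n`-invariant
monomial ideal -/

section ExtendedPartitions

variable (K : Type) [Field K] (n : ℕ)

/-- `ℓ(μ)`: the number of entries of `μ ∈ P_n^∞` equal to `∞`. -/
def ellInf (μ : Fin n → ℕ∞) : ℕ := (Finset.univ.filter fun i => μ i = ⊤).card

/-- The largest finite entry of `μ ∈ P_n^∞` (i.e. the first finite entry, `μ` being
weakly decreasing). -/
def topVal (μ : Fin n → ℕ∞) : ℕ := Finset.univ.sup fun i => (μ i).toNat

/-- `μ^+ ∈ P_n`: each `∞` entry of `μ` is replaced by (largest finite entry)` + 1`. -/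
def plusOf (μ : Fin n → ℕ∞) (i : Fin n) : ℕ :=
  if μ i = ⊤ then topVal n μ + 1 else (μ i).toNat

/-- `μ̃ = μ^+ + (0^{ℓ(μ)}, 1^{n - ℓ(μ)}) ∈ P_n`. -/
def tildeOf (μ : Fin n → ℕ∞) (i : Fin n) : ℕ :=
  if μ i = ⊤ then topVal n μ + 1 else (μ i).toNat + 1

/-- The ideal `Q_μ = ∩_{σ ∈ S_n} σ((x_k^{μ_k + 1}, …, x_n^{μ_n + 1}))`, where
`μ_k, …, μ_n` are the finite entries of `μ ∈ P_n^∞`. -/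
noncomputable def Qgen (μ : Fin n → ℕ∞) : Ideal (MvPolynomial (Fin n) K) :=
  ⨅ σ : Equiv.Perm (Fin n),
    Ideal.map (MvPolynomial.rename σ).toRingHom
      (Ideal.span {g | ∃ i : Fin n, μ i ≠ ⊤ ∧ g = MvPolynomial.X i ^ ((μ i).toNat + 1)})

/-- `Λ` is the (finite) set of dual generators of `I`, i.e. `I = ∩_{μ ∈ Λ} Q_μ` is the
irredundant presentation of `I` by ideals `Q_μ`. -/
def IsDualPresentation (I : Ideal (MvPolynomial (Fin n) K))
    (Λ : Finset (Fin n → ℕ∞)) : Prop :=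
  (∀ μ ∈ Λ, Antitone μ) ∧ (I = ⨅ μ ∈ Λ, Qgen K n μ) ∧
    ∀ μ ∈ Λ, I ≠ ⨅ ρ ∈ Λ, ⨅ _ : ρ ≠ μ, Qgen K n ρ

/-- The partial order `≼` on dual generators: `μ ≼ ρ` iff `μ̃ ≤ ρ̃` (componentwise) and
`ℓ(μ) - ℓ(ρ) ≤ |ρ̃| - |μ̃|`. -/
def preceq (μ ρ : Fin n → ℕ∞) : Prop :=
  (∀ i, tildeOf n μ i ≤ tildeOf n ρ i) ∧
    (∑ i, tildeOf n μ i) + ellInf n μ ≤ (∑ i, tildeOf n ρ i) + ellInf n ρ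

/-- The extended partition `ρ = (∞^{p_0}, d_1^{p_1}, …, d_s^{p_s}) ∈ P_n^∞`
(so `n = p 0 + p 1 + ⋯ + p s`), as a function of the position `i ∈ {0, …, n-1}`. -/
def rhoOf (s : ℕ) (d p : ℕ → ℕ) (i : ℕ) : ℕ∞ :=
  if blkOf p (s + 1) i = 0 then ⊤ else ((d (blkOf p (s + 1) i) : ℕ) : ℕ∞)

end ExtendedPartitions

/-- Extend `c : (k : Fin s) → Fin (p k)` (i.e. a vector `0 ≤ c ≤ p(μ)`) to a
function `ℕ → ℕ`. -/
def cExt (s : ℕ) (p : ℕ → ℕ) (c : (k : Fin s) → Fin (p k)) (j : ℕ) : ℕ :=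
  if h : j < s then (c ⟨j, h⟩ : ℕ) else 0

section Clifford

variable (K : Type) [Field K]

/-- The sign with which the vertex `v` is removed from the face `F`. -/
def faceSign (F : Finset ℕ) (v : ℕ) : K := (-1) ^ (F.filter fun u => u ≤ v).card

/-- The free vector space on all finite sets of vertices. -/
def FaceMod : Type := Finset ℕ →₀ K

instance : AddCommGroup (FaceMod K) := inferInstanceAs (AddCommGroup (Finset ℕ →₀ K))

instance : Module K (FaceMod K) := inferInstanceAs (Module K (Finset ℕ →₀ K))

/-- The basis of the free vector space on all faces. -/
def face : Module.Basis (Finset ℕ) K (FaceMod K) :=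
  (Finsupp.basisSingleOne : Module.Basis (Finset ℕ) K (Finset ℕ →₀ K))

/-- The endomorphism of the free space on all faces with prescribed values on faces. -/
def faceOp (φ : Finset ℕ → FaceMod K) : Module.End K (FaceMod K) :=
  (face K).constr K φ

/-- Removal of the vertex `v`, with sign. -/
def ann (v : ℕ) : Module.End K (FaceMod K) :=
  faceOp K fun F => if v ∈ F then faceSign K F v • face K (F.erase v) else 0

/-- Insertion of the vertex `u`, with sign. -/
def cre (u : ℕ) : Module.End K (FaceMod K) :=
  faceOp K fun F => if u ∈ F then 0 else
    faceSign K (insert u F) u • face K (insert u F)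

/-- The coordinate projection onto the faces in `A`. -/
def proj (A : Set (Finset ℕ)) : Module.End K (FaceMod K) :=
  faceOp K fun F => if F ∈ A then face K F else 0

/-- The simplicial boundary removing only vertices in `W`. -/
def bdry (W : Finset ℕ) : Module.End K (FaceMod K) := ∑ v ∈ W, ann K v

variable {K}

@[simp] theorem faceOp_single (φ : Finset ℕ → FaceMod K) (F : Finset ℕ) :
    faceOp K φ (face K F) = φ F := by
  simp [faceOp]

theorem ann_single (v : ℕ) (F : Finset ℕ) : ann K v (face K F) =
    if v ∈ F then faceSign K F v • face K (F.erase v) else 0 :=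
  faceOp_single _ _

theorem cre_single (u : ℕ) (F : Finset ℕ) : cre K u (face K F) =
    if u ∈ F then 0 else faceSign K (insert u F) u • face K (insert u F) :=
  faceOp_single _ _

theorem proj_single (A : Set (Finset ℕ)) (F : Finset ℕ) : proj K A (face K F) =
    if F ∈ A then face K F else 0 :=
  faceOp_single _ _

theorem faceEnd_ext {f g : Module.End K (FaceMod K)}
    (h : ∀ F, f (face K F) = g (face K F)) : f = g :=
  (face K).ext h

@[simp] theorem faceSign_mul_self (F : Finset ℕ) (v : ℕ) : faceSign K F v * faceSign K F v = 1 := by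
  rw [faceSign, ← mul_pow]; simp

theorem faceSign_ne_zero (F : Finset ℕ) (v : ℕ) : faceSign K F v ≠ 0 :=
  left_ne_zero_of_mul (faceSign_mul_self (K := K) F v ▸ one_ne_zero)

theorem faceSign_erase_of_lt {F : Finset ℕ} {u v : ℕ} (hu : u ∈ F) (h : u < v) :
    faceSign K (F.erase u) v = -faceSign K F v := by
  have : (F.filter fun x => x ≤ v) = insert u ((F.erase u).filter fun x => x ≤ v) := by
    ext x; simp only [Finset.mem_filter, Finset.mem_insert, Finset.mem_erase]; grind
  rw [faceSign, faceSign, this, Finset.card_insert_of_notMem (by simp), pow_succ]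
  simp

theorem faceSign_erase_of_gt {F : Finset ℕ} {u v : ℕ} (h : v < u) :
    faceSign K (F.erase u) v = faceSign K F v := by
  have : (F.filter fun x => x ≤ v) = ((F.erase u).filter fun x => x ≤ v) := by
    ext x; simp only [Finset.mem_filter, Finset.mem_erase]; grind
  rw [faceSign, faceSign, this]

theorem faceSign_anticomm {F : Finset ℕ} {u v : ℕ} (hu : u ∈ F) (hv : v ∈ F) (h : u ≠ v) :
    faceSign K F u * faceSign K (F.erase u) v = -(faceSign K F v * faceSign K (F.erase v) u) := by
  rcases lt_or_gt_of_ne h with h | h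
  · rw [faceSign_erase_of_lt hu h, faceSign_erase_of_gt h]; ring
  · rw [faceSign_erase_of_lt hv h, faceSign_erase_of_gt h]; ring

theorem ann_mul_self (v : ℕ) : ann K v * ann K v = 0 := by
  refine faceEnd_ext fun F => ?_
  by_cases h : v ∈ F <;> simp [ann_single, h]

theorem ann_mul_ann (u v : ℕ) : ann K u * ann K v = -(ann K v * ann K u) := by
  rcases eq_or_ne u v with rfl | h
  · simp [ann_mul_self]
  refine faceEnd_ext fun F => ?_
  by_cases hu : u ∈ F <;> by_cases hv : v ∈ F <;>
    simp [ann_single, hu, hv, h, h.symm, smul_smul]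
  rw [Finset.erase_right_comm (a := v), faceSign_anticomm hv hu h.symm]
  simp

theorem cre_mul_ann {u v : ℕ} (h : u ≠ v) : cre K u * ann K v = -(ann K v * cre K u) := by
  refine faceEnd_ext fun F => ?_
  by_cases hu : u ∈ F <;> by_cases hv : v ∈ F <;>
    simp [ann_single, cre_single, hu, hv, h, h.symm, smul_smul]
  rw [Finset.erase_insert_of_ne h]
  have h1 := faceSign_anticomm (K := K) (F := insert u F) (u := u) (v := v) (by simp)
    (by simp [hv]) h
  rw [Finset.erase_insert hu, Finset.erase_insert_of_ne h] at h1
  rw [← neg_smul]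
  congr 1
  have h2 := faceSign_mul_self (K := K) (insert u (F.erase v)) u
  have h3 := faceSign_mul_self (K := K) (insert u F) u
  set a := faceSign K (insert u F) v
  set b := faceSign K (insert u F) u
  set c := faceSign K F v
  set e := faceSign K (insert u (F.erase v)) u
  linear_combination (b * e) * h1 - c * e * h3 - a * b * h2

theorem ann_mul_cre_self (u : ℕ) : ann K u * cre K u + cre K u * ann K u = 1 := by
  refine faceEnd_ext fun F => ?_
  by_cases hu : u ∈ F <;>
    simp [ann_single, cre_single, hu, smul_smul]

theorem bdry_mul_ann (W : Finset ℕ) (v : ℕ) : bdry K W * ann K v = -(ann K v * bdry K W) := by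
  rw [bdry, Finset.sum_mul, Finset.mul_sum, ← Finset.sum_neg_distrib]
  exact Finset.sum_congr rfl fun u _ => ann_mul_ann u v

theorem bdry_mul_self (W : Finset ℕ) : bdry K W * bdry K W = 0 := by
  induction W using Finset.induction_on with
  | empty => simp [bdry]
  | insert v W hv ih =>
    have : bdry K (insert v W) = ann K v + bdry K W := Finset.sum_insert hv
    rw [this, add_mul, mul_add, mul_add, ih, ann_mul_self, bdry_mul_ann]
    simp

theorem bdry_mul_cre {W : Finset ℕ} {u : ℕ} (hu : u ∈ W) :
    bdry K W * cre K u = 1 - cre K u * bdry K W := by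
  have h : bdry K W = ann K u + bdry K (W.erase u) := (Finset.add_sum_erase W _ hu).symm
  have h2 : bdry K (W.erase u) * cre K u = -(cre K u * bdry K (W.erase u)) := by
    rw [bdry, Finset.sum_mul, Finset.mul_sum, ← Finset.sum_neg_distrib]
    refine Finset.sum_congr rfl fun v hv => ?_
    rw [cre_mul_ann (Finset.ne_of_mem_erase hv).symm, neg_neg]
  rw [h, add_mul, mul_add, h2, ← ann_mul_cre_self u]
  abel

variable (K) in
/-- The transvection `e_v ↦ e_v - e_u` of the exterior algebra. -/
def transv (u v : ℕ) : Module.End K (FaceMod K) := 1 - cre K u * ann K v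

theorem isUnit_transv {u v : ℕ} (h : u ≠ v) : IsUnit (transv K u v) := by
  have h0 : (cre K u * ann K v) * (cre K u * ann K v) = 0 := by
    calc _ = cre K u * (ann K v * cre K u) * ann K v := by noncomm_ring
      _ = -(cre K u * cre K u * (ann K v * ann K v)) := by
        rw [← neg_neg (ann K v * cre K u), ← cre_mul_ann h]; noncomm_ring
      _ = 0 := by rw [ann_mul_self]; simp
  refine ⟨⟨transv K u v, 1 + cre K u * ann K v, ?_, ?_⟩, rfl⟩
  · rw [transv, sub_mul, mul_add, mul_add, h0]; simp
  · rw [transv, add_mul, mul_sub, mul_sub, h0]; simp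

theorem bdry_mul_transv {W : Finset ℕ} {u v : ℕ} (hu : u ∈ W) (hv : v ∈ W) :
    bdry K W * transv K u v = transv K u v * bdry K (W.erase v) := by
  have h : bdry K W = ann K v + bdry K (W.erase v) := (Finset.add_sum_erase W _ hv).symm
  have h1 : bdry K (W.erase v) = bdry K W - ann K v := by rw [h]; abel
  have h2 := bdry_mul_cre (K := K) hu
  have h3 := bdry_mul_ann (K := K) W v
  have h4 := ann_mul_self (K := K) v
  calc bdry K W * transv K u v = bdry K W - (bdry K W * cre K u) * ann K v := by
        rw [transv]; noncomm_ring
    _ = bdry K W - ann K v + cre K u * (bdry K W * ann K v) := by rw [h2]; noncomm_ring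
    _ = bdry K W - ann K v - cre K u * (ann K v * bdry K W) + cre K u * (ann K v * ann K v) := by
        rw [h3, h4]; noncomm_ring
    _ = _ := by rw [transv, h1]; noncomm_ring

theorem proj_mul_proj (A B : Set (Finset ℕ)) : proj K A * proj K B = proj K (A ∩ B) := by
  refine faceEnd_ext fun F => ?_
  by_cases ha : F ∈ A <;> by_cases hb : F ∈ B <;> simp [proj_single, ha, hb]

theorem proj_mul_transv {A : Set (Finset ℕ)} {u v : ℕ} (huv : u ≠ v)
    (hA : ∀ F, v ∈ F → u ∉ F → (insert u (F.erase v) ∈ A ↔ F ∈ A)) :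
    proj K A * transv K u v = transv K u v * proj K A := by
  have : proj K A * (cre K u * ann K v) = (cre K u * ann K v) * proj K A := by
    refine faceEnd_ext fun F => ?_
    by_cases hv : v ∈ F <;> by_cases hu : u ∈ F <;> by_cases hF : F ∈ A <;>
      simp [proj_single, ann_single, cre_single, hv, hu, hF, huv, hA]
  rw [transv, mul_sub, this]
  noncomm_ring

theorem bdry_single (W F : Finset ℕ) : bdry K W (face K F) =
    ∑ v ∈ W ∩ F, faceSign K F v • face K (F.erase v) := by
  rw [bdry, LinearMap.sum_apply, ← Finset.filter_mem_eq_inter, Finset.sum_filter]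
  simp only [ann_single]

end Clifford

section Rank

variable {K : Type} [Field K]

/-- The faces of `S` with `t` vertices. -/
def layer (S : Set (Finset ℕ)) (t : ℤ) : Set (Finset ℕ) := {F | F ∈ S ∧ (F.card : ℤ) = t}

/-- The part of the boundary removing vertices in `W` which goes from the faces of `S` with `t`
vertices to those with `t - 1` vertices. -/
def layerBdry (K : Type) [Field K] (S : Set (Finset ℕ)) (W : Finset ℕ) (t : ℤ) :
    Module.End K (FaceMod K) :=
  proj K (layer S (t - 1)) * bdry K W * proj K (layer S t)

/-- The rank of `layerBdry`. -/
def faceRank (K : Type) [Field K] (S : Set (Finset ℕ)) (W : Finset ℕ) (t : ℤ) : ℕ :=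
  Module.finrank K (LinearMap.range (layerBdry K S W t))

/-- The condition that makes the truncated boundary on `S` a differential. -/
def FaceConvex (S : Set (Finset ℕ)) : Prop :=
  ∀ F ∈ S, ∀ u ∈ F, ∀ v ∈ F, u ≠ v → (F.erase u).erase v ∈ S → F.erase u ∈ S

theorem range_proj (A : Set (Finset ℕ)) :
    LinearMap.range (proj K A) = Submodule.span K (face K '' A) := by
  rw [LinearMap.range_eq_map, ← (face K).span_eq, Submodule.map_span]
  apply le_antisymm
  · rw [Submodule.span_le]
    rintro _ ⟨_, ⟨F, rfl⟩, rfl⟩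
    rw [proj_single]
    split_ifs with h
    · exact Submodule.subset_span ⟨F, h, rfl⟩
    · exact zero_mem _
  · apply Submodule.span_mono
    rintro _ ⟨F, h, rfl⟩
    exact ⟨_, ⟨F, rfl⟩, by rw [proj_single, if_pos h]⟩

theorem finrank_range_proj (A : Set (Finset ℕ)) :
    Module.finrank K (LinearMap.range (proj K A)) = A.ncard := by
  have h : LinearIndependent K (fun x : A => face K x.1) :=
    (face K).linearIndependent.comp _ Subtype.val_injective
  rw [range_proj, Set.image_eq_range, Module.finrank, rank_span h,
    Cardinal.mk_range_eq _ h.injective]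
  rfl

theorem finiteDimensional_range_proj {A : Set (Finset ℕ)} (hA : A.Finite) :
    FiniteDimensional K (LinearMap.range (proj K A)) := by
  rw [range_proj]
  exact FiniteDimensional.span_of_finite K (hA.image _)

theorem finite_layer {S : Set (Finset ℕ)} {W : Finset ℕ} (hS : ∀ F ∈ S, F ⊆ W) (t : ℤ) :
    (layer S t).Finite :=
  W.powerset.finite_toSet.subset fun F hF => by simpa using hS F hF.1

theorem layer_eq_empty_of_neg (S : Set (Finset ℕ)) {t : ℤ} (ht : t < 0) : layer S t = ∅ := by
  ext F
  simp only [layer, Set.mem_ofPred_eq, Set.mem_empty_iff_false, iff_false]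
  omega

theorem proj_empty : proj K ∅ = 0 := by
  exact faceEnd_ext fun F => by rw [proj_single, if_neg (Set.notMem_empty F)]; rfl

theorem finrank_range_eq_zero {f : Module.End K (FaceMod K)} (h : f = 0) :
    Module.finrank K (LinearMap.range f) = 0 := by
  rw [h, LinearMap.range_zero, finrank_bot]

theorem faceRank_eq_zero (S : Set (Finset ℕ)) (W : Finset ℕ) {t : ℤ} (ht : t ≤ 0) :
    faceRank K S W t = 0 := by
  refine finrank_range_eq_zero ?_
  rw [layerBdry, layer_eq_empty_of_neg S (by omega : t - 1 < 0), proj_empty, zero_mul, zero_mul]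

theorem layerBdry_mul_layerBdry {S : Set (Finset ℕ)} (W : Finset ℕ) (hc : FaceConvex S) (t : ℤ) :
    layerBdry K S W t * layerBdry K S W (t + 1) = 0 := by
  have key : proj K (layer S (t - 1)) * bdry K W * (1 - proj K (layer S t)) * bdry K W *
      proj K (layer S (t + 1)) = 0 := by
    refine faceEnd_ext fun F => ?_
    by_cases hF : F ∈ layer S (t + 1)
    swap
    · simp [proj_single, hF]
    simp only [Module.End.mul_apply, proj_single, if_pos hF, bdry_single, map_sum, map_smul,
      LinearMap.zero_apply]
    refine Finset.sum_eq_zero fun u hu => ?_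
    rw [Finset.mem_inter] at hu
    rw [LinearMap.sub_apply, proj_single, Module.End.one_apply]
    split_ifs with h
    · simp
    rw [sub_zero, bdry_single, map_sum, Finset.sum_eq_zero, smul_zero]
    intro v hv
    simp only [Finset.mem_inter, Finset.mem_erase] at hv
    rw [map_smul, proj_single, if_neg, smul_zero]
    rintro ⟨h1, -⟩
    refine h ⟨hc F hF.1 u hu.2 v hv.2.2 (Ne.symm hv.2.1) h1, ?_⟩
    rw [Finset.card_erase_of_mem hu.2]
    have h2 : (F.card : ℤ) = t + 1 := hF.2
    have : 0 < F.card := Finset.card_pos.2 ⟨u, hu.2⟩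
    omega
  have hpp : proj K (layer S t) * proj K (layer S t) = proj K (layer S t) := by
    rw [proj_mul_proj, Set.inter_self]
  have h2 := bdry_mul_self (K := K) W
  rw [layerBdry, layerBdry, add_sub_cancel_right]
  calc _ = proj K (layer S (t - 1)) * bdry K W * (proj K (layer S t) * proj K (layer S t)) *
        bdry K W * proj K (layer S (t + 1)) := by noncomm_ring
    _ = proj K (layer S (t - 1)) * (bdry K W * bdry K W) * proj K (layer S (t + 1)) -
        proj K (layer S (t - 1)) * bdry K W * (1 - proj K (layer S t)) * bdry K W *
      proj K (layer S (t + 1)) := by rw [hpp]; noncomm_ring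
    _ = 0 := by rw [h2, key]; simp

/-- The inclusion of chains into the free space on all faces. -/
def chainIncl (K : Type) [Field K] (S : Set (Finset ℕ)) (j : ℕ) :
    (ChainIdx (lab S) j →₀ K) →ₗ[K] FaceMod K :=
  Finsupp.linearCombination K fun q => face K q.1.2

theorem chainIncl_injective (S : Set (Finset ℕ)) (j : ℕ) :
    Function.Injective (chainIncl K S j) :=
  (face K).linearIndependent.comp (fun q : ChainIdx (lab S) j => q.1.2) fun _ _ h =>
    Subtype.ext (Prod.ext rfl h)

theorem range_chainIncl (S : Set (Finset ℕ)) (j : ℕ) :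
    LinearMap.range (chainIncl K S j) = LinearMap.range (proj K (layer S j)) := by
  rw [range_proj, chainIncl, Finsupp.range_linearCombination]
  congr 1
  ext x
  constructor
  · rintro ⟨q, rfl⟩
    exact ⟨q.1.2, ⟨q.2.1, by exact_mod_cast q.2.2⟩, rfl⟩
  · rintro ⟨F, ⟨h1, h2⟩, rfl⟩
    exact ⟨⟨((), F), h1, by exact_mod_cast h2⟩, rfl⟩

theorem chainIncl_comp_bd {S : Set (Finset ℕ)} {W : Finset ℕ} (hS : ∀ F ∈ S, F ⊆ W) (j : ℕ) :
    chainIncl K S j ∘ₗ bd K (lab S) j =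
      (proj K (layer S j) * bdry K W) ∘ₗ chainIncl K S (j + 1) := by
  refine Finsupp.lhom_ext' fun q => LinearMap.ext_ring ?_
  simp only [LinearMap.comp_apply, bd, chainIncl, Finsupp.lsingle_apply,
    Finsupp.linearCombination_single, one_smul, Module.End.mul_apply, bdry_single, bdElt, map_sum,
    map_smul]
  rw [Finset.inter_eq_right.2 (hS _ q.2.1)]
  refine Finset.sum_congr rfl fun v hv => ?_
  have hcard : (q.1.2.erase v).card = j := by
    rw [Finset.card_erase_of_mem hv, q.2.2, Nat.add_sub_cancel]
  rw [proj_single]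
  by_cases h : q.1.2.erase v ∈ S
  · refine (congrArg (chainIncl K S j) (dif_pos ⟨h, hcard⟩)).trans ?_
    rw [if_pos ⟨h, by exact_mod_cast hcard⟩]
    refine (map_smul _ _ _).trans (congrArg _ ?_)
    exact (Finsupp.linearCombination_single _ _ _).trans (one_smul _ _)
  · refine (congrArg (chainIncl K S j) (dif_neg (fun h' => h h'.1))).trans ?_
    rw [if_neg (fun h' => h h'.1), map_zero, smul_zero]

theorem finrank_range_bd {S : Set (Finset ℕ)} {W : Finset ℕ} (hS : ∀ F ∈ S, F ⊆ W) (j : ℕ) :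
    Module.finrank K (LinearMap.range (bd K (lab S) j)) = faceRank K S W (j + 1) := by
  have h1 : LinearMap.range (layerBdry K S W (j + 1)) =
      (LinearMap.range (bd K (lab S) j)).map (chainIncl K S j) := by
    rw [← LinearMap.range_comp, chainIncl_comp_bd hS, LinearMap.range_comp, range_chainIncl,
      layerBdry, add_sub_cancel_right, Module.End.mul_eq_comp, LinearMap.range_comp]
    norm_cast
  rw [faceRank, h1]
  exact (LinearEquiv.finrank_eq
    (Submodule.equivMapOfInjective _ (chainIncl_injective S j) _))

theorem finrank_chains (S : Set (Finset ℕ)) (j : ℕ) :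
    Module.finrank K (ChainIdx (lab S) j →₀ K) = (layer S j).ncard := by
  rw [← finrank_range_proj (K := K), ← range_chainIncl]
  exact (LinearMap.finrank_range_of_inj (chainIncl_injective S j)).symm

theorem range_bd_le_cycles {S : Set (Finset ℕ)} {W : Finset ℕ} (hS : ∀ F ∈ S, F ⊆ W)
    (hc : FaceConvex S) (j : ℕ) : LinearMap.range (bd K (lab S) j) ≤ cycles K (lab S) j := by
  cases j with
  | zero => exact le_top
  | succ j =>
    rintro _ ⟨x, rfl⟩
    refine LinearMap.mem_ker.2 (chainIncl_injective S j ?_)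
    have e1 := LinearMap.congr_fun (chainIncl_comp_bd (K := K) hS j) (bd K (lab S) (j + 1) x)
    have e2 := LinearMap.congr_fun (chainIncl_comp_bd (K := K) hS (j + 1)) x
    simp only [LinearMap.comp_apply] at e1 e2
    rw [e1, e2, map_zero]
    have hx : chainIncl K S (j + 1 + 1) x ∈ LinearMap.range (proj K (layer S (j + 1 + 1 : ℕ))) := by
      rw [← range_chainIncl]; exact ⟨x, rfl⟩
    obtain ⟨y, hy⟩ := hx
    rw [← hy]
    have e3 := LinearMap.congr_fun (layerBdry_mul_layerBdry (K := K) W hc (j + 1)) y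
    have hpp : proj K (layer S (j + 1)) * proj K (layer S (j + 1)) = proj K (layer S (j + 1)) := by
      rw [proj_mul_proj, Set.inter_self]
    have hpp' := LinearMap.congr_fun hpp
    simp only [Module.End.mul_apply] at hpp'
    simp only [layerBdry, add_sub_cancel_right, Module.End.mul_apply, hpp'] at e3
    push_cast
    simpa only [Module.End.mul_apply, LinearMap.zero_apply] using e3

theorem hdim0_eq {S : Set (Finset ℕ)} {W : Finset ℕ} (hS : ∀ F ∈ S, F ⊆ W)
    (hc : FaceConvex S) (t : ℤ) :
    (hdim0 K S (t - 1) : ℤ) =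
      (layer S t).ncard - faceRank K S W t - faceRank K S W (t + 1) := by
  rw [hdim0, hdim, sub_add_cancel]
  split_ifs with ht
  swap
  · rw [layer_eq_empty_of_neg S (by omega), faceRank_eq_zero _ _ (by omega),
      faceRank_eq_zero _ _ (by omega)]
    simp
  lift t to ℕ using ht
  have hfin : ∀ j : ℕ, FiniteDimensional K (ChainIdx (lab S) j →₀ K) := fun j => by
    have := finiteDimensional_range_proj (K := K) (finite_layer hS j)
    rw [← range_chainIncl] at this
    exact (LinearEquiv.ofInjective _ (chainIncl_injective (K := K) S j)).symm.finiteDimensional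
  have hcyc : (Module.finrank K (cycles K (lab S) t) : ℤ) =
      (layer S t).ncard - faceRank K S W t := by
    cases t with
    | zero =>
      rw [faceRank_eq_zero _ _ (by simp), cycles, finrank_top, finrank_chains]
      simp
    | succ j =>
      have := hfin (j + 1)
      have h := LinearMap.finrank_range_add_finrank_ker (bd K (lab S) j)
      rw [finrank_chains, finrank_range_bd hS] at h
      rw [cycles, ← h]
      push_cast
      ring
  have hle := range_bd_le_cycles (K := K) hS hc t
  have := hfin t
  rw [Int.toNat_natCast, rhd, inf_eq_left.2 hle, Nat.cast_sub (Submodule.finrank_mono hle), hcyc,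
    finrank_range_bd hS]

theorem finrank_range_mul_add {f P Q : Module.End K (FaceMod K)}
    (hf : FiniteDimensional K (LinearMap.range f)) (hP : P * P = P) (hQ : Q * Q = Q)
    (hPQ : P * Q = 0) (hQP : Q * P = 0) (hfP : f * P = P * f) (hfQ : f * Q = Q * f) :
    Module.finrank K (LinearMap.range (f * (P + Q))) =
      Module.finrank K (LinearMap.range (f * P)) + Module.finrank K (LinearMap.range (f * Q)) := by
  have h1 : LinearMap.range (f * P) ≤ LinearMap.range f := LinearMap.range_comp_le_range _ _
  have h2 : LinearMap.range (f * Q) ≤ LinearMap.range f := LinearMap.range_comp_le_range _ _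
  have := Submodule.finiteDimensional_of_le h1
  have := Submodule.finiteDimensional_of_le h2
  have hsup : LinearMap.range (f * (P + Q)) =
      LinearMap.range (f * P) ⊔ LinearMap.range (f * Q) := by
    apply le_antisymm
    · rw [mul_add]
      exact LinearMap.range_add_le _ _
    · apply sup_le
      · have : f * P = (f * (P + Q)) * P := by rw [mul_assoc, add_mul, hP, hQP, add_zero]
        rw [this]
        exact LinearMap.range_comp_le_range _ _
      · have : f * Q = (f * (P + Q)) * Q := by rw [mul_assoc, add_mul, hQ, hPQ, zero_add]
        rw [this]
        exact LinearMap.range_comp_le_range _ _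
  have hinf : LinearMap.range (f * P) ⊓ LinearMap.range (f * Q) = ⊥ := by
    rw [eq_bot_iff]
    rintro x ⟨⟨y, rfl⟩, z, hz⟩
    have e1 : P * (f * P) = f * P := by rw [hfP, ← mul_assoc, hP]
    have e2 : P * (f * Q) = 0 := by rw [hfQ, ← mul_assoc, hPQ, zero_mul]
    rw [Submodule.mem_bot, ← e1, Module.End.mul_apply, ← hz, ← Module.End.mul_apply, e2,
      LinearMap.zero_apply]
  have := Submodule.finrank_sup_add_finrank_inf_eq (LinearMap.range (f * P))
    (LinearMap.range (f * Q))
  rw [hinf, finrank_bot, add_zero] at this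
  rw [hsup, this]

theorem finrank_range_mul_sum {f : Module.End K (FaceMod K)} {ι : Type} (s : Finset ι)
    (P : ι → Module.End K (FaceMod K)) (hf : FiniteDimensional K (LinearMap.range f))
    (hP : ∀ i, P i * P i = P i) (hPQ : ∀ i j, i ≠ j → P i * P j = 0)
    (hfP : ∀ i, f * P i = P i * f) :
    Module.finrank K (LinearMap.range (f * ∑ i ∈ s, P i)) =
      ∑ i ∈ s, Module.finrank K (LinearMap.range (f * P i)) := by
  suffices h : (∑ i ∈ s, P i) * (∑ i ∈ s, P i) = ∑ i ∈ s, P i ∧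
      (Module.finrank K (LinearMap.range (f * ∑ i ∈ s, P i)) =
      ∑ i ∈ s, Module.finrank K (LinearMap.range (f * P i))) from h.2
  induction s using Finset.induction_on with
  | empty => exact ⟨mul_zero _, finrank_range_eq_zero (mul_zero _)⟩
  | insert a s ha ih =>
    have h1 : P a * ∑ i ∈ s, P i = 0 := by
      rw [Finset.mul_sum]
      exact Finset.sum_eq_zero fun i hi => hPQ _ _ (by rintro rfl; exact ha hi)
    have h2 : (∑ i ∈ s, P i) * P a = 0 := by
      rw [Finset.sum_mul]
      exact Finset.sum_eq_zero fun i hi => hPQ _ _ (by rintro rfl; exact ha hi)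
    rw [Finset.sum_insert ha, Finset.sum_insert ha]
    refine ⟨by rw [add_mul, mul_add, mul_add, h1, h2, ih.1, hP]; simp, ?_⟩
    rw [finrank_range_mul_add hf (hP a) ih.1 h1 h2 (hfP a), ih.2]
    rw [Finset.mul_sum, Finset.sum_mul]
    exact Finset.sum_congr rfl fun i _ => hfP i

end Rank

section Decomposition

variable {K : Type} [Field K]

theorem finrank_range_eq_of_isUnit {f g T : Module.End K (FaceMod K)} (hT : IsUnit T)
    (h : f * T = T * g) :
    Module.finrank K (LinearMap.range f) = Module.finrank K (LinearMap.range g) := by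
  have hb := (Module.End.isUnit_iff T).1 hT
  have h1 : LinearMap.range f = (LinearMap.range g).map T := by
    rw [← LinearMap.range_comp, ← Module.End.mul_eq_comp, ← h, Module.End.mul_eq_comp,
      LinearMap.range_comp_of_range_eq_top _ (LinearMap.range_eq_top.2 hb.2)]
  rw [h1]
  exact (LinearEquiv.finrank_eq (Submodule.equivMapOfInjective _ hb.1 _)).symm

theorem faceRank_erase {S : Set (Finset ℕ)} {W : Finset ℕ} {u v : ℕ} (hu : u ∈ W) (hv : v ∈ W)
    (huv : u ≠ v) (hS : ∀ F, v ∈ F → u ∉ F → (insert u (F.erase v) ∈ S ↔ F ∈ S)) (t : ℤ) :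
    faceRank K S W t = faceRank K S (W.erase v) t := by
  have hp : ∀ t, proj K (layer S t) * transv K u v = transv K u v * proj K (layer S t) := by
    intro t
    refine proj_mul_transv huv fun F hvF huF => ?_
    have : (insert u (F.erase v)).card = F.card := by
      rw [Finset.card_insert_of_notMem (by simp [huF]), Finset.card_erase_add_one hvF]
    simp only [layer, Set.mem_ofPred_eq, this, hS F hvF huF]
  refine finrank_range_eq_of_isUnit (isUnit_transv huv) ?_
  rw [layerBdry, layerBdry, mul_assoc, hp, ← mul_assoc, mul_assoc (proj K _),
    bdry_mul_transv hu hv, ← mul_assoc, hp]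
  noncomm_ring

theorem faceRank_eq_of_subset {S : Set (Finset ℕ)} {W Q : Finset ℕ} (hQ : Q ⊆ W)
    (hS : ∀ v ∈ W \ Q, ∃ u ∈ Q, ∀ F, v ∈ F → u ∉ F → (insert u (F.erase v) ∈ S ↔ F ∈ S))
    (t : ℤ) : faceRank K S W t = faceRank K S Q t := by
  suffices h : ∀ X ⊆ W \ Q, faceRank K S W t = faceRank K S (W \ X) t by
    rw [h _ subset_rfl, Finset.sdiff_sdiff_eq_self hQ]
  intro X
  induction X using Finset.induction_on with
  | empty => simp
  | insert v X hv ih =>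
    intro hX
    rw [ih ((Finset.subset_insert _ _).trans hX)]
    have hvW := hX (Finset.mem_insert_self v X)
    obtain ⟨u, hu, h⟩ := hS v hvW
    rw [Finset.mem_sdiff] at hvW
    have huX : u ∉ X := fun h' =>
      (Finset.mem_sdiff.1 (hX (Finset.mem_insert_of_mem h'))).2 hu
    rw [faceRank_erase (u := u) (v := v) (by simp [hQ hu, huX]) (by simp [hvW.1, hv])
      (by rintro rfl; exact hvW.2 hu) h]
    congr 1
    ext x
    simp only [Finset.mem_erase, Finset.mem_sdiff, Finset.mem_insert]
    tauto

/-- The faces of `S` whose part outside `Q` is `E`. -/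
def facePart (S : Set (Finset ℕ)) (Q E : Finset ℕ) : Set (Finset ℕ) := {F | F ∈ S ∧ F \ Q = E}

theorem layer_facePart (S : Set (Finset ℕ)) (Q E : Finset ℕ) (t : ℤ) :
    layer (facePart S Q E) t = layer S t ∩ {F | F \ Q = E} := by
  ext F
  simp only [layer, facePart, Set.mem_ofPred_eq, Set.mem_inter_iff]
  tauto

theorem bdry_mul_proj_sdiff (Q E : Finset ℕ) :
    bdry K Q * proj K {F | F \ Q = E} = proj K {F | F \ Q = E} * bdry K Q := by
  refine faceEnd_ext fun F => ?_
  have h : ∀ v ∈ Q ∩ F, (F.erase v) \ Q = F \ Q := by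
    intro v hv
    rw [Finset.mem_inter] at hv
    ext x
    simp only [Finset.mem_erase, Finset.mem_sdiff]
    constructor
    · tauto
    · rintro ⟨h1, h2⟩
      exact ⟨⟨fun h => h2 (h ▸ hv.1), h1⟩, h2⟩
  simp only [Module.End.mul_apply, proj_single, bdry_single, map_sum, map_smul, Set.mem_ofPred_eq]
  split_ifs with hF
  · rw [bdry_single]
    exact Finset.sum_congr rfl fun v hv => by rw [if_pos ((h v hv).trans hF)]
  · rw [map_zero]
    symm
    exact Finset.sum_eq_zero fun v hv => by rw [if_neg (fun h' => hF ((h v hv).symm.trans h')),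
      smul_zero]

theorem layerBdry_mul_proj_sdiff (S : Set (Finset ℕ)) (Q E : Finset ℕ) (t : ℤ) :
    layerBdry K (facePart S Q E) Q t = layerBdry K S Q t * proj K {F | F \ Q = E} := by
  have h1 := bdry_mul_proj_sdiff (K := K) Q E
  have h2 : proj K {F | F \ Q = E} * proj K {F | F \ Q = E} = proj K {F | F \ Q = E} := by
    rw [proj_mul_proj, Set.inter_self]
  have h3 : proj K (layer S t) * proj K {F | F \ Q = E} =
      proj K {F | F \ Q = E} * proj K (layer S t) := by
    rw [proj_mul_proj, proj_mul_proj, Set.inter_comm]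
  rw [layerBdry, layerBdry, layer_facePart, layer_facePart, ← proj_mul_proj, ← proj_mul_proj, h3]
  calc _ = proj K (layer S (t - 1)) * (proj K {F | F \ Q = E} * bdry K Q) *
        proj K {F | F \ Q = E} * proj K (layer S t) := by noncomm_ring
    _ = proj K (layer S (t - 1)) * bdry K Q * (proj K {F | F \ Q = E} *
        proj K {F | F \ Q = E}) * proj K (layer S t) := by rw [← h1]; noncomm_ring
    _ = _ := by rw [h2, mul_assoc, ← h3]; noncomm_ring

theorem layerBdry_comm_proj_sdiff (S : Set (Finset ℕ)) (Q E : Finset ℕ) (t : ℤ) :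
    layerBdry K S Q t * proj K {F | F \ Q = E} = proj K {F | F \ Q = E} * layerBdry K S Q t := by
  have h1 := bdry_mul_proj_sdiff (K := K) Q E
  have h3 : ∀ t, proj K (layer S t) * proj K {F | F \ Q = E} =
      proj K {F | F \ Q = E} * proj K (layer S t) := fun t => by
    rw [proj_mul_proj, proj_mul_proj, Set.inter_comm]
  rw [layerBdry, mul_assoc, h3, ← mul_assoc, mul_assoc _ (bdry K Q), h1, ← mul_assoc, h3]
  noncomm_ring

theorem proj_sdiff_orthogonal {Q E E' : Finset ℕ} (h : E ≠ E') :
    proj K {F | F \ Q = E} * proj K {F | F \ Q = E'} = 0 := by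
  rw [proj_mul_proj, ← proj_empty]
  congr 1
  ext F
  simp only [Set.mem_inter_iff, Set.mem_ofPred_eq, Set.mem_empty_iff_false, iff_false]
  rintro ⟨rfl, h'⟩
  exact h h'

theorem proj_mul_sum_proj_sdiff {S : Set (Finset ℕ)} {W : Finset ℕ} (hS : ∀ F ∈ S, F ⊆ W)
    (Q : Finset ℕ) (t : ℤ) :
    proj K (layer S t) * ∑ E ∈ (W \ Q).powerset, proj K {F | F \ Q = E} = proj K (layer S t) := by
  rw [Finset.mul_sum]
  refine faceEnd_ext fun F => ?_
  rw [LinearMap.sum_apply]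
  simp only [proj_mul_proj, proj_single]
  split_ifs with hF
  · rw [Finset.sum_eq_single (F \ Q)]
    · rw [if_pos ⟨hF, rfl⟩]
    · intro E _ hE
      rw [if_neg (fun h => hE h.2.symm)]
    · intro h
      exact absurd (Finset.mem_powerset.2 (Finset.sdiff_subset_sdiff (hS F hF.1) subset_rfl)) h
  · exact Finset.sum_eq_zero fun E _ => if_neg fun h => hF h.1

theorem faceRank_eq_sum_facePart {S : Set (Finset ℕ)} {W : Finset ℕ} (hS : ∀ F ∈ S, F ⊆ W)
    (Q : Finset ℕ) (t : ℤ) :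
    faceRank K S Q t = ∑ E ∈ (W \ Q).powerset, faceRank K (facePart S Q E) Q t := by
  have hfin : FiniteDimensional K (LinearMap.range (layerBdry K S Q t)) := by
    have := finiteDimensional_range_proj (K := K) (finite_layer hS (t - 1))
    refine Submodule.finiteDimensional_of_le
      (S₂ := LinearMap.range (proj K (layer S (t - 1)))) ?_
    rw [layerBdry, mul_assoc]
    exact LinearMap.range_comp_le_range _ _
  have h := finrank_range_mul_sum (W \ Q).powerset (fun E => proj K {F | F \ Q = E}) hfin
    (fun E => by rw [proj_mul_proj, Set.inter_self]) (fun E E' => proj_sdiff_orthogonal)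
    (fun E => layerBdry_comm_proj_sdiff S Q E t)
  rw [layerBdry, mul_assoc, proj_mul_sum_proj_sdiff hS] at h
  rw [faceRank, layerBdry, h]
  refine Finset.sum_congr rfl fun E _ => ?_
  rw [faceRank, layerBdry_mul_proj_sdiff, layerBdry]

theorem ncard_layer_eq_sum_facePart {S : Set (Finset ℕ)} {W : Finset ℕ} (hS : ∀ F ∈ S, F ⊆ W)
    (Q : Finset ℕ) (t : ℤ) :
    (layer S t).ncard = ∑ E ∈ (W \ Q).powerset, (layer (facePart S Q E) t).ncard := by
  have h := finrank_range_mul_sum (K := ℚ) (W \ Q).powerset (fun E => proj ℚ {F | F \ Q = E})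
    (finiteDimensional_range_proj (finite_layer hS t))
    (fun E => by rw [proj_mul_proj, Set.inter_self]) (fun E E' => proj_sdiff_orthogonal)
    (fun E => by rw [proj_mul_proj, proj_mul_proj, Set.inter_comm])
  rw [proj_mul_sum_proj_sdiff hS, finrank_range_proj] at h
  rw [h]
  refine Finset.sum_congr rfl fun E _ => ?_
  rw [layer_facePart, ← finrank_range_proj (K := ℚ), ← proj_mul_proj]

end Decomposition

section Duality

variable {K : Type} [Field K]

theorem finrank_range_eq_rank {A B : Set (Finset ℕ)} [Fintype A] [Fintype B]
    (D : Module.End K (FaceMod K)) :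
    Module.finrank K (LinearMap.range (proj K B * D * proj K A)) =
      (Matrix.of fun (b : B) (a : A) => (face K).repr (D (face K a)) b).rank := by
  set M : Matrix B A K := Matrix.of fun b a => (face K).repr (D (face K a)) b
  have hli : ∀ X : Set (Finset ℕ), LinearIndependent K (fun x : X => face K x.1) := fun X =>
    (face K).linearIndependent.comp _ Subtype.val_injective
  let iA : (A → K) →ₗ[K] FaceMod K := Fintype.linearCombination K fun a : A => face K a.1
  let iB : (B → K) →ₗ[K] FaceMod K := Fintype.linearCombination K fun b : B => face K b.1
  have hiB : Function.Injective iB := (hli B).fintypeLinearCombination_injective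
  have hrA : LinearMap.range iA = LinearMap.range (proj K A) := by
    rw [Fintype.range_linearCombination, range_proj, Set.image_eq_range]
  have hcomp : (proj K B * D) ∘ₗ iA = iB ∘ₗ M.mulVecLin := by
    refine LinearMap.pi_ext' fun a => LinearMap.ext_ring ?_
    have h1 : iA (Pi.single a 1) = face K a.1 := by
      rw [Fintype.linearCombination_apply_single, one_smul]
    have h2 : ∀ x : FaceMod K, proj K B x = iB fun b => (face K).repr x b := by
      intro x
      have : proj K B = iB ∘ₗ LinearMap.pi fun b : B => (face K).coord b.1 := by
        refine faceEnd_ext fun F => ?_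
        rw [proj_single, LinearMap.comp_apply, Fintype.linearCombination_apply]
        simp only [LinearMap.pi_apply, Module.Basis.coord_apply, Module.Basis.repr_self,
          Finsupp.single_apply]
        split_ifs with h
        · rw [Finset.sum_eq_single ⟨F, h⟩]
          · simp
          · intro b _ hb
            rw [if_neg (fun h' => hb (Subtype.ext h'.symm)), zero_smul]
          · simp
        · symm
          exact Finset.sum_eq_zero fun b _ => by
            rw [if_neg (fun h' : F = b.1 => h (by rw [h']; exact b.2)), zero_smul]
      rw [this]
      rfl
    simp only [LinearMap.comp_apply, LinearMap.coe_single, h1, Module.End.mul_apply,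
      Matrix.mulVecLin_apply, Matrix.mulVec_single_one]
    rw [h2]
    rfl
  rw [Module.End.mul_eq_comp (proj K B * D), LinearMap.range_comp, ← hrA, ← LinearMap.range_comp,
    hcomp, LinearMap.range_comp, Matrix.rank]
  exact (LinearEquiv.finrank_eq (Submodule.equivMapOfInjective _ hiB _)).symm

theorem finrank_range_eq_of_transpose {A B A' B' : Set (Finset ℕ)} (hA' : A'.Finite)
    (hB' : B'.Finite) {D D' : Module.End K (FaceMod K)} {ψ : Finset ℕ → Finset ℕ}
    (hA : Set.BijOn ψ A' A) (hB : Set.BijOn ψ B' B) {x : Finset ℕ → K} (hx : ∀ F, x F ≠ 0)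
    (h : ∀ a ∈ A', ∀ b ∈ B', x a * (face K).repr (D (face K (ψ a))) (ψ b) =
      x b * (face K).repr (D' (face K b)) a) :
    Module.finrank K (LinearMap.range (proj K B * D * proj K A)) =
      Module.finrank K (LinearMap.range (proj K A' * D' * proj K B')) := by
  let eA : A' ≃ A := hA.equiv ψ
  let eB : B' ≃ B := hB.equiv ψ
  have := hA'.fintype
  have := hB'.fintype
  have := Fintype.ofEquiv _ eA
  have := Fintype.ofEquiv _ eB
  rw [finrank_range_eq_rank, finrank_range_eq_rank]
  set M : Matrix B A K := Matrix.of fun b a => (face K).repr (D (face K a)) b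
  set N : Matrix A' B' K := Matrix.of fun a b => (face K).repr (D' (face K b)) a
  have hdet : ∀ (X : Set (Finset ℕ)) [Fintype X],
      (Matrix.diagonal fun a : X => x a.1).det ≠ 0 := fun X _ => by
    rw [Matrix.det_diagonal]
    exact Finset.prod_ne_zero_iff.2 fun a _ => hx _
  have hMN : M.submatrix eB eA * Matrix.diagonal (fun a : A' => x a.1) =
      Matrix.diagonal (fun b : B' => x b.1) * N.transpose := by
    ext b a
    rw [Matrix.mul_diagonal, Matrix.diagonal_mul, mul_comm]
    exact h a a.2 b b.2
  calc M.rank = (M.submatrix eB eA).rank := (Matrix.rank_submatrix M eB eA).symm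
    _ = (M.submatrix eB eA * Matrix.diagonal fun a : A' => x a.1).rank :=
      (Matrix.rank_mul_eq_left_of_det_ne_zero _ _ (hdet A')).symm
    _ = N.transpose.rank := by
      rw [hMN]
      exact Matrix.rank_mul_eq_right_of_det_ne_zero _ _ (hdet B')
    _ = N.rank := Matrix.rank_transpose N

/-- Two systems of nonzero incidence numbers on a cube differ by a diagonal rescaling, if their
ratio `r` commutes on squares. -/
theorem exists_rescaling {U : Finset ℕ} {r : Finset ℕ → ℕ → K} (hr : ∀ G g, r G g ≠ 0)
    (hcomm : ∀ G ⊆ U, ∀ g ∈ G, ∀ h ∈ G, g ≠ h →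
      r G g * r (G.erase g) h = r G h * r (G.erase h) g) :
    ∃ x : Finset ℕ → K, (∀ G, x G ≠ 0) ∧ ∀ G ⊆ U, ∀ g ∈ G, x G = r G g * x (G.erase g) := by
  let x : Finset ℕ → K := fun G => ∏ g ∈ G, r (G.filter fun u => u ≤ g) g
  have hmax : ∀ (G : Finset ℕ) (m : ℕ), (∀ g ∈ G, g < m) →
      x (insert m G) = r (insert m G) m * x G := by
    intro G m hm
    have hmG : m ∉ G := fun h => lt_irrefl _ (hm m h)
    simp only [x]
    rw [Finset.prod_insert hmG]
    congr 1
    · congr 1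
      exact Finset.filter_true_of_mem fun g hg => by
        rcases Finset.mem_insert.1 hg with rfl | hg
        · exact le_rfl
        · exact (hm g hg).le
    · refine Finset.prod_congr rfl fun g hg => ?_
      rw [Finset.filter_insert, if_neg (not_le.2 (hm g hg))]
  refine ⟨x, fun G => Finset.prod_ne_zero_iff.2 fun g _ => hr _ _, fun G => ?_⟩
  induction G using Finset.induction_on_max with
  | empty => simp
  | insert m G hm ih =>
    intro hU g hg
    have hmG : m ∉ G := fun h => lt_irrefl _ (hm m h)
    rcases Finset.mem_insert.1 hg with rfl | hgG
    · rw [hmax G g hm, Finset.erase_insert hmG]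
    · have hgm : m ≠ g := (hm g hgG).ne'
      have e := hcomm _ hU g hg m (Finset.mem_insert_self _ _) hgm.symm
      rw [Finset.erase_insert hmG, Finset.erase_insert_of_ne hgm] at e
      rw [hmax G m hm, ih ((Finset.subset_insert _ _).trans hU) g hgG,
        Finset.erase_insert_of_ne hgm,
        hmax _ m (fun u hu => hm u (Finset.mem_of_mem_erase hu)), ← mul_assoc, ← mul_assoc, e]

theorem repr_bdry {W F : Finset ℕ} {v : ℕ} (hW : v ∈ W) (hF : v ∈ F) :
    (face K).repr (bdry K W (face K F)) (F.erase v) = faceSign K F v := by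
  rw [bdry_single, map_sum, Finsupp.finsetSum_apply, Finset.sum_eq_single v]
  · simp
  · intro u hu huv
    rw [map_smul, Module.Basis.repr_self, Finsupp.smul_apply, Finsupp.single_apply, if_neg,
      smul_zero]
    intro h
    have : u ∈ F.erase v := Finset.mem_erase.2 ⟨huv, (Finset.mem_inter.1 hu).2⟩
    rw [← h] at this
    exact Finset.notMem_erase _ _ this
  · intro h
    exact absurd (Finset.mem_inter.2 ⟨hW, hF⟩) h

theorem repr_bdry_eq_zero {W F F' : Finset ℕ} (h : ∀ v ∈ W, v ∈ F → F.erase v ≠ F') :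
    (face K).repr (bdry K W (face K F)) F' = 0 := by
  rw [bdry_single, map_sum, Finsupp.finsetSum_apply]
  refine Finset.sum_eq_zero fun v hv => ?_
  rw [Finset.mem_inter] at hv
  rw [map_smul, Module.Basis.repr_self, Finsupp.smul_apply, Finsupp.single_apply,
    if_neg (h v hv.1 hv.2), smul_zero]

/-- The face with part `E` outside the image of `q`, and part inside the image of `q` given by the
complement of `H` in `{0, …, s-1}`. -/
def coFace (s : ℕ) (q : ℕ → ℕ) (E H : Finset ℕ) : Finset ℕ := E ∪ (Finset.range s \ H).image q

/-- The dual complex of the faces of `S` with part `E` outside the image of `q`. -/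
def coLink (S : Set (Finset ℕ)) (s : ℕ) (q : ℕ → ℕ) (E : Finset ℕ) : Set (Finset ℕ) :=
  {H | H ⊆ Finset.range s ∧ coFace s q E H ∈ S}

section CoFace

variable {s : ℕ} {q : ℕ → ℕ} {E : Finset ℕ} (hq : Set.InjOn q (Finset.range s))
  (hE : Disjoint E ((Finset.range s).image q))

theorem finite_layer_coLink (S : Set (Finset ℕ)) (t : ℤ) : (layer (coLink S s q E) t).Finite :=
  finite_layer (W := Finset.range s) (fun _ h => h.1) t

include hq hE

theorem coFace_mem_iff {H : Finset ℕ} {g : ℕ} (hg : g < s) :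
    q g ∈ coFace s q E H ↔ g ∉ H := by
  have h1 : q g ∉ E := fun h =>
    Finset.disjoint_left.1 hE h (Finset.mem_image_of_mem _ (Finset.mem_range.2 hg))
  simp only [coFace, Finset.mem_union, h1, false_or, Finset.mem_image, Finset.mem_sdiff]
  constructor
  · rintro ⟨k, ⟨hk, hkH⟩, e⟩
    rwa [← hq hk (Finset.mem_coe.2 (Finset.mem_range.2 hg)) e]
  · exact fun h => ⟨g, ⟨Finset.mem_range.2 hg, h⟩, rfl⟩

theorem coFace_injOn : Set.InjOn (coFace s q E) {H | H ⊆ Finset.range s} := by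
  intro H hH H' hH' e
  have key : ∀ g < s, (g ∈ H ↔ g ∈ H') := fun g hg => by
    rw [← not_iff_not, ← coFace_mem_iff hq hE hg, e, coFace_mem_iff hq hE hg]
  ext g
  constructor
  · exact fun h => (key g (Finset.mem_range.1 (hH h))).1 h
  · exact fun h => (key g (Finset.mem_range.1 (hH' h))).2 h

theorem card_coFace {H : Finset ℕ} (hH : H ⊆ Finset.range s) :
    ((coFace s q E H).card : ℤ) = s + E.card - H.card := by
  rw [coFace, Finset.card_union_of_disjoint, Finset.card_image_of_injOn,
    Finset.card_sdiff_of_subset hH, Finset.card_range]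
  · have : H.card ≤ s := by simpa using Finset.card_le_card hH
    push_cast [this]
    ring
  · exact hq.mono (by intro x hx; simp at hx ⊢; exact hx.1)
  · exact hE.mono_right (Finset.image_subset_image Finset.sdiff_subset)

theorem coFace_erase {H : Finset ℕ} {g : ℕ} (hg : g < s) (hgH : g ∈ H) :
    (coFace s q E (H.erase g)).erase (q g) = coFace s q E H := by
  have h1 := coFace_mem_iff hq hE (H := H) hg
  have : coFace s q E (H.erase g) = insert (q g) (coFace s q E H) := by
    rw [coFace, coFace, ← Finset.union_insert, ← Finset.image_insert]
    congr 2
    ext x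
    simp only [Finset.mem_sdiff, Finset.mem_erase, Finset.mem_insert, Finset.mem_range]
    grind
  rw [this, Finset.erase_insert (by rw [h1]; simpa using hgH)]

theorem bijOn_coFace (S : Set (Finset ℕ)) (t : ℤ) :
    Set.BijOn (coFace s q E) (layer (coLink S s q E) (s + E.card - t))
      (layer (facePart S ((Finset.range s).image q) E) t) := by
  refine ⟨?_, (coFace_injOn hq hE).mono fun H hH => hH.1.1, ?_⟩
  · rintro H ⟨⟨h1, h2⟩, h3⟩
    refine ⟨⟨h2, ?_⟩, by rw [card_coFace hq hE h1]; omega⟩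
    rw [coFace, Finset.union_sdiff_distrib, Finset.sdiff_eq_self_of_disjoint hE,
      Finset.sdiff_eq_empty_iff_subset.2 (Finset.image_subset_image Finset.sdiff_subset),
      Finset.union_empty]
  · rintro F ⟨⟨h1, h2⟩, h3⟩
    have hF : coFace s q E ((Finset.range s).filter fun k => q k ∉ F) = F := by
      ext v
      simp only [coFace, Finset.mem_union, Finset.mem_image, Finset.mem_sdiff, Finset.mem_filter,
        ← h2, Finset.mem_range]
      grind
    refine ⟨(Finset.range s).filter fun k => q k ∉ F, ⟨⟨Finset.filter_subset _ _, ?_⟩, ?_⟩, hF⟩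
    · rwa [hF]
    · have := card_coFace hq hE (Finset.filter_subset (fun k => q k ∉ F) (Finset.range s))
      rw [hF] at this
      omega

theorem ncard_layer_facePart (S : Set (Finset ℕ)) (t : ℤ) :
    (layer (facePart S ((Finset.range s).image q) E) t).ncard =
      (layer (coLink S s q E) (s + E.card - t)).ncard :=
  (bijOn_coFace hq hE S t).image_eq ▸ (bijOn_coFace hq hE S t).injOn.ncard_image

theorem faceRank_facePart (S : Set (Finset ℕ)) (t : ℤ) :
    faceRank K (facePart S ((Finset.range s).image q) E) ((Finset.range s).image q) t =
      faceRank K (coLink S s q E) (Finset.range s) (s + E.card - t + 1) := by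
  let r : Finset ℕ → ℕ → K := fun G g =>
    faceSign K (coFace s q E (G.erase g)) (q g) * faceSign K G g
  obtain ⟨x, hx0, hx⟩ := exists_rescaling (U := Finset.range s) (r := r)
    (fun G g => mul_ne_zero (faceSign_ne_zero _ _) (faceSign_ne_zero _ _)) (by
      intro G hG g hg h hh hgh
      have hgs := Finset.mem_range.1 (hG hg)
      have hhs := Finset.mem_range.1 (hG hh)
      have hqgh : q g ≠ q h := fun e => hgh (hq (Finset.mem_coe.2 (hG hg)) (hG hh) e)
      have e1 := coFace_erase hq hE hhs (H := G.erase g) (Finset.mem_erase.2 ⟨hgh.symm, hh⟩)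
      have e2 := coFace_erase hq hE hgs (H := G.erase h) (Finset.mem_erase.2 ⟨hgh, hg⟩)
      have e3 := faceSign_anticomm (K := K) (F := G) hg hh hgh
      have e4 := faceSign_anticomm (K := K) (F := coFace s q E ((G.erase g).erase h))
        (u := q g) (v := q h) ((coFace_mem_iff hq hE hgs).2 (by simp))
        ((coFace_mem_iff hq hE hhs).2 (by simp)) hqgh
      rw [Finset.erase_right_comm] at e2
      rw [e1, e2] at e4
      simp only [r]
      rw [Finset.erase_right_comm (a := h)]
      linear_combination (-faceSign K (coFace s q E ((G.erase g).erase h)) (q g) *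
        faceSign K (coFace s q E (G.erase h)) (q h)) * e3 +
          faceSign K G g * faceSign K (G.erase g) h * e4)
  rw [faceRank, faceRank, layerBdry, layerBdry, add_sub_cancel_right]
  have hB := bijOn_coFace hq hE S (t - 1)
  rw [show (s : ℤ) + E.card - (t - 1) = s + E.card - t + 1 by ring] at hB
  refine finrank_range_eq_of_transpose (finite_layer_coLink _ _)
    (finite_layer_coLink _ _) (bijOn_coFace hq hE S t) hB hx0 ?_
  rintro H ⟨⟨hH, -⟩, -⟩ H2 ⟨⟨hH2, -⟩, -⟩
  by_cases hg : ∃ g ∈ H2, H = H2.erase g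
  · obtain ⟨g, hg, rfl⟩ := hg
    have hgs := Finset.mem_range.1 (hH2 hg)
    rw [repr_bdry (hH2 hg) hg, hx H2 hH2 g hg]
    rw [← coFace_erase hq hE hgs hg, repr_bdry (Finset.mem_image_of_mem _ (hH2 hg))
      ((coFace_mem_iff hq hE hgs).2 (by simp))]
    have := faceSign_mul_self (K := K) H2 g
    simp only [r]
    linear_combination (-x (H2.erase g) * faceSign K (coFace s q E (H2.erase g)) (q g)) * this
  · rw [repr_bdry_eq_zero, repr_bdry_eq_zero, mul_zero, mul_zero]
    · rintro v - hv rfl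
      exact hg ⟨v, hv, rfl⟩
    · intro v hv hvF e
      obtain ⟨g, hgs, rfl⟩ := Finset.mem_image.1 hv
      have hgs' := Finset.mem_range.1 hgs
      have hgH := (coFace_mem_iff hq hE hgs').1 hvF
      have h1 := coFace_erase hq hE hgs' (Finset.mem_insert_self g H)
      rw [Finset.erase_insert hgH, e] at h1
      have h2 := coFace_injOn hq hE hH2 (Finset.insert_subset hgs hH) h1
      exact hg ⟨g, by rw [h2]; simp, by rw [h2, Finset.erase_insert hgH]⟩

end CoFace

theorem faceConvex_coLink {S : Set (Finset ℕ)} {s : ℕ} {q : ℕ → ℕ} {E : Finset ℕ}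
    (hq : Set.InjOn q (Finset.range s)) (hE : Disjoint E ((Finset.range s).image q))
    (hS : FaceConvex S) : FaceConvex (coLink S s q E) := by
  rintro H ⟨hH, hHS⟩ g hg h hh hgh ⟨-, h2⟩
  refine ⟨(Finset.erase_subset _ _).trans hH, ?_⟩
  have hgs := Finset.mem_range.1 (hH hg)
  have hhs := Finset.mem_range.1 (hH hh)
  have hqgh : q g ≠ q h := fun e => hgh (hq (Finset.mem_coe.2 (hH hg)) (hH hh) e)
  have e1 := coFace_erase hq hE hhs (H := H.erase g) (Finset.mem_erase.2 ⟨hgh.symm, hh⟩)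
  have e2 := coFace_erase hq hE hgs hg
  rw [← e1]
  refine hS _ h2 (q h) ((coFace_mem_iff hq hE hhs).2 (by simp)) (q g)
    ((coFace_mem_iff hq hE hgs).2 (by simp)) hqgh.symm ?_
  rwa [e1, e2]

/-- The homology of a family of faces which is symmetric within blocks, as a sum over the parts of
faces outside a set of block representatives. -/
theorem rhd0_eq_sum_coLink {S : Set (Finset ℕ)} {W : Finset ℕ} {s : ℕ} {q : ℕ → ℕ}
    (hSW : ∀ F ∈ S, F ⊆ W) (hc : FaceConvex S) (hq : Set.InjOn q (Finset.range s))
    (hqW : (Finset.range s).image q ⊆ W)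
    (hS : ∀ v ∈ W \ (Finset.range s).image q, ∃ u ∈ (Finset.range s).image q,
      ∀ F, v ∈ F → u ∉ F → (insert u (F.erase v) ∈ S ↔ F ∈ S)) (i : ℕ) :
    rhd0 K S i = ∑ E ∈ (W \ (Finset.range s).image q).powerset,
      hdim0 K (coLink S s q E) ((s : ℤ) - i - 1 + E.card) := by
  have h0 : rhd0 K S i = hdim0 K S ((i : ℤ) - 1) := by
    rw [rhd0, hdim0, hdim, sub_add_cancel, if_pos (by positivity), Int.toNat_natCast]
  rw [h0]
  have hZ : ((hdim0 K S ((i : ℤ) - 1) : ℕ) : ℤ) =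
      ((∑ E ∈ (W \ (Finset.range s).image q).powerset,
        hdim0 K (coLink S s q E) ((s : ℤ) - i - 1 + E.card) : ℕ) : ℤ) := by
    rw [hdim0_eq hSW hc, faceRank_eq_of_subset hqW hS, faceRank_eq_of_subset hqW hS,
      faceRank_eq_sum_facePart hSW, faceRank_eq_sum_facePart hSW, ncard_layer_eq_sum_facePart hSW
      ((Finset.range s).image q)]
    push_cast
    rw [← Finset.sum_sub_distrib, ← Finset.sum_sub_distrib]
    refine Finset.sum_congr rfl fun E hE => ?_
    have hE : Disjoint E ((Finset.range s).image q) :=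
      Finset.disjoint_of_subset_left (Finset.mem_powerset.1 hE) Finset.sdiff_disjoint
    rw [ncard_layer_facePart hq hE, faceRank_facePart hq hE, faceRank_facePart hq hE,
      show (s : ℤ) - i - 1 + E.card = (s + E.card - i) - 1 by ring,
      hdim0_eq (fun F h => h.1) (faceConvex_coLink hq hE hc),
      show (s : ℤ) + E.card - (i + 1) + 1 = s + E.card - i by ring]
    ring
  exact_mod_cast hZ

end Duality

section MonomialIdeals

variable {K : Type} [Field K] {n : ℕ} {I : Ideal (MvPolynomial (Fin n) K)}

theorem mon_mem_of_le {a b : Fin n → ℕ} (h : a ≤ b) (ha : mon K n a ∈ I) : mon K n b ∈ I := by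
  refine I.mem_of_dvd (MvPolynomial.monomial_dvd_monomial.2 ⟨Or.inr ?_, dvd_rfl⟩) ha
  exact fun i => h i

theorem rename_mon (σ : Equiv.Perm (Fin n)) (a : Fin n → ℕ) :
    MvPolynomial.rename σ (mon K n a) = mon K n (a ∘ σ.symm) := by
  rw [mon, mon, MvPolynomial.rename_monomial]
  refine congrArg (fun x => MvPolynomial.monomial x (1 : K)) (Finsupp.ext fun i => ?_)
  rw [← Finsupp.equivMapDomain_eq_mapDomain]
  rfl

theorem mon_comp_mem_iff (hI : IsSymmetricIdeal K n I) (σ : Equiv.Perm (Fin n)) (a : Fin n → ℕ) :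
    mon K n (a ∘ σ) ∈ I ↔ mon K n a ∈ I := by
  have key : ∀ (τ : Equiv.Perm (Fin n)) (b : Fin n → ℕ), mon K n b ∈ I → mon K n (b ∘ τ) ∈ I := by
    intro τ b hb
    have := Ideal.mem_map_of_mem (MvPolynomial.rename (R := K) τ.symm).toRingHom hb
    rw [hI τ.symm] at this
    simpa [rename_mon] using this
  refine ⟨fun h => ?_, key σ a⟩
  simpa [Function.comp_assoc] using key σ.symm _ h

end MonomialIdeals

theorem exists_perm_comp_eq {α β : Type} [Fintype α] {f g : α → β}
    (h : ∀ y, (Finset.univ.filter fun a => f a = y).card =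
      (Finset.univ.filter fun a => g a = y).card) :
    ∃ σ : Equiv.Perm α, g ∘ σ = f := by
  have h' : ∀ y, Fintype.card {a // f a = y} = Fintype.card {a // g a = y} := fun y => by
    rw [Fintype.card_subtype, Fintype.card_subtype, h]
  refine ⟨(Equiv.sigmaFiberEquiv f).symm.trans
    ((Equiv.sigmaCongrRight fun y => Fintype.equivOfCardEq (h' y)).trans
      (Equiv.sigmaFiberEquiv g)), ?_⟩
  ext a
  exact (Fintype.equivOfCardEq (h' (f a)) ⟨a, rfl⟩).2

section Blocks

variable {p : ℕ → ℕ} {s : ℕ}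

theorem cumsum_succ (p : ℕ → ℕ) (k : ℕ) : cumsum p (k + 1) = cumsum p k + p k :=
  Finset.sum_range_succ p k

theorem cumsum_mono (p : ℕ → ℕ) : Monotone (cumsum p) :=
  monotone_nat_of_le_succ fun k => by rw [cumsum_succ]; omega

theorem exists_cumsum_le_lt {i m : ℕ} (h : i < cumsum p (m + 1)) :
    ∃ k ≤ m, cumsum p k ≤ i ∧ i < cumsum p (k + 1) := by
  induction m with
  | zero => exact ⟨0, le_rfl, by simp [cumsum], h⟩
  | succ m ih =>
    by_cases h' : i < cumsum p (m + 1)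
    · obtain ⟨k, hk, h1⟩ := ih h'
      exact ⟨k, by omega, h1⟩
    · exact ⟨m + 1, le_rfl, not_lt.1 h', h⟩

theorem blkOf_eq {i k : ℕ} (hk : k ≤ s) (h1 : cumsum p k ≤ i) (h2 : i < cumsum p (k + 1)) :
    blkOf p s i = k := by
  have : (Finset.range s).filter (fun j => cumsum p (j + 1) ≤ i) = Finset.range k := by
    ext j
    simp only [Finset.mem_filter, Finset.mem_range]
    refine ⟨fun h => ?_, fun h => ⟨by omega, (cumsum_mono p h).trans h1⟩⟩
    by_contra hj
    have := cumsum_mono p (show k + 1 ≤ j + 1 by omega)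
    omega
  rw [blkOf, this, Finset.card_range]

theorem blkOf_le (p : ℕ → ℕ) (s i : ℕ) : blkOf p s i ≤ s :=
  (Finset.card_filter_le _ _).trans (Finset.card_range s).le

theorem blkOf_eq_iff {i k : ℕ} (hi : i < cumsum p (s + 1)) (hk : k ≤ s) :
    blkOf p s i = k ↔ cumsum p k ≤ i ∧ i < cumsum p (k + 1) := by
  refine ⟨fun h => ?_, fun h => blkOf_eq hk h.1 h.2⟩
  obtain ⟨j, hj, h1, h2⟩ := exists_cumsum_le_lt hi
  obtain rfl : j = k := (blkOf_eq hj h1 h2).symm.trans h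
  exact ⟨h1, h2⟩

theorem card_filter_blkOf {k : ℕ} (hk : k ≤ s) :
    ((Finset.range (cumsum p (s + 1))).filter fun i => blkOf p s i = k).card = p k := by
  have : (Finset.range (cumsum p (s + 1))).filter (fun i => blkOf p s i = k) =
      Finset.Ico (cumsum p k) (cumsum p (k + 1)) := by
    ext i
    rw [Finset.mem_filter, Finset.mem_range, Finset.mem_Ico]
    have := cumsum_mono p (show k + 1 ≤ s + 1 by omega)
    refine ⟨fun h => (blkOf_eq_iff h.1 hk).1 h.2, fun h => ?_⟩
    have hi : i < cumsum p (s + 1) := by omega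
    exact ⟨hi, (blkOf_eq_iff hi hk).2 h⟩
  rw [this, Nat.card_Ico, cumsum_succ, Nat.add_sub_cancel_left]

theorem card_filter_blkOf_end {k c : ℕ} (hk : k ≤ s) (hc : c ≤ p k) :
    ((Finset.range (cumsum p (s + 1))).filter fun i =>
      blkOf p s i = k ∧ p k - c ≤ i - cumsum p k).card = c := by
  have : (Finset.range (cumsum p (s + 1))).filter
      (fun i => blkOf p s i = k ∧ p k - c ≤ i - cumsum p k) =
      Finset.Ico (cumsum p (k + 1) - c) (cumsum p (k + 1)) := by
    ext i
    rw [Finset.mem_filter, Finset.mem_range, Finset.mem_Ico]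
    have := cumsum_mono p (show k + 1 ≤ s + 1 by omega)
    have := cumsum_succ p k
    refine ⟨fun ⟨h1, h2, h3⟩ => ?_, fun h => ?_⟩
    · have := (blkOf_eq_iff h1 hk).1 h2
      omega
    · have hi : i < cumsum p (s + 1) := by omega
      exact ⟨hi, (blkOf_eq_iff hi hk).2 (by omega), by omega⟩
  rw [this, Nat.card_Ico, cumsum_succ]
  omega

end Blocks

theorem card_filter_fin (n : ℕ) (P : ℕ → Prop) [DecidablePred P] :
    (Finset.univ.filter fun i : Fin n => P i).card = ((Finset.range n).filter P).card := by
  rw [← Finset.card_map Fin.valEmbedding]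
  congr 1
  ext j
  simp only [Finset.mem_map, Finset.mem_filter, Finset.mem_univ, true_and, Fin.valEmbedding_apply,
    Finset.mem_range]
  exact ⟨fun ⟨i, h, e⟩ => e ▸ ⟨i.2, h⟩, fun ⟨h1, h2⟩ => ⟨⟨j, h1⟩, h2, rfl⟩⟩

theorem exists_perm_of_card_filter {α : Type} [Fintype α] {f g : α → ℕ} {P Q : α → Prop}
    [DecidablePred P] [DecidablePred Q] (h : ∀ k, (Finset.univ.filter fun a => f a = k).card =
      (Finset.univ.filter fun a => g a = k).card)
    (hPQ : ∀ k, (Finset.univ.filter fun a => f a = k ∧ P a).card =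
      (Finset.univ.filter fun a => g a = k ∧ Q a).card) :
    ∃ σ : Equiv.Perm α, ∀ a, g (σ a) = f a ∧ (Q (σ a) ↔ P a) := by
  obtain ⟨σ, hσ⟩ := exists_perm_comp_eq (f := fun a => (f a, P a)) (g := fun a => (g a, Q a)) (by
    rintro ⟨k, R⟩
    by_cases hR : R
    · simpa [Prod.ext_iff, hR] using hPQ k
    · have h1 := Finset.card_filter_add_card_filter_not (s := Finset.univ.filter fun a => f a = k) P
      have h2 := Finset.card_filter_add_card_filter_not (s := Finset.univ.filter fun a => g a = k) Q
      rw [Finset.filter_filter, Finset.filter_filter] at h1 h2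
      have h3 := h k
      have h4 := hPQ k
      simp only [Prod.ext_iff, hR, eq_iff_iff, iff_false]
      omega)
  refine ⟨σ, fun a => ?_⟩
  have := congrFun hσ a
  simpa [Prod.ext_iff] using this

section Rearrangement

variable {K : Type} [Field K] {n s : ℕ} {d p b : ℕ → ℕ} {I : Ideal (MvPolynomial (Fin n) K)}

theorem mon_sub_mem_iff (hI : IsSymmetricIdeal K n I) (hn : n = cumsum p (s + 1))
    (hbs : ∀ j < n, b j ≤ s)
    (hb : ∀ k ≤ s, ((Finset.range n).filter fun j => b j = k).card = p k)
    {F : Finset ℕ} (hF : ∀ j ∈ F, j < n ∧ b j < s) {C : ℕ → ℕ} (hCp : ∀ k < s, C k ≤ p k)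
    (hC : ∀ k < s, (F.filter fun j => b j = k).card = C k) :
    mon K n (fun i => (if b i < s then d (b i) else 0) - eF F i) ∈ I ↔
      mon K n (fun i => muMinus s d p C i) ∈ I := by
  obtain ⟨σ, hσ⟩ := exists_perm_of_card_filter (α := Fin n) (f := fun i => b i)
    (g := fun i => blkOf p s i) (P := fun i => (i : ℕ) ∈ F)
    (Q := fun i => blkOf p s i < s ∧ p (blkOf p s i) - C (blkOf p s i) ≤
      i - cumsum p (blkOf p s i)) (fun k => by
    rw [card_filter_fin n fun j => b j = k, card_filter_fin n fun j => blkOf p s j = k]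
    by_cases hk : k ≤ s
    · rw [hb k hk, hn, card_filter_blkOf hk]
    · rw [Finset.filter_false_of_mem, Finset.filter_false_of_mem]
      · exact fun i _ h => hk (h ▸ blkOf_le p s i)
      · exact fun i hi h => hk (h ▸ hbs i (Finset.mem_range.1 hi))) (fun k => by
    rw [card_filter_fin n fun j => b j = k ∧ j ∈ F, card_filter_fin n fun j => blkOf p s j = k ∧
      blkOf p s j < s ∧ p (blkOf p s j) - C (blkOf p s j) ≤ j - cumsum p (blkOf p s j)]
    by_cases hk : k < s
    · trans C k
      · rw [← hC k hk]
        congr 1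
        ext j
        simp only [Finset.mem_filter, Finset.mem_range]
        exact ⟨fun h => ⟨h.2.2, h.2.1⟩, fun h => ⟨(hF j h.1).1, h.2, h.1⟩⟩
      · conv_lhs => rw [← card_filter_blkOf_end hk.le (hCp k hk), ← hn]
        congr 1
        ext j
        simp only [Finset.mem_filter]
        constructor
        · rintro ⟨h1, rfl, h3⟩
          exact ⟨h1, rfl, hk, h3⟩
        · rintro ⟨h1, rfl, -, h3⟩
          exact ⟨h1, rfl, h3⟩
    · rw [Finset.filter_false_of_mem, Finset.filter_false_of_mem]
      · exact fun i _ h => hk (h.1 ▸ h.2.1)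
      · exact fun i _ h => hk (h.1 ▸ (hF i h.2).2))
  rw [← mon_comp_mem_iff hI σ fun i : Fin n => muMinus s d p C i]
  refine iff_of_eq (congrArg (fun x => mon K n x ∈ I) (funext fun i => ?_))
  obtain ⟨h1, h2⟩ := hσ i
  rw [h1] at h2
  simp only [Function.comp_apply, muMinus, h1, eF]
  by_cases hs : b i < s
  · simp only [hs, true_and, if_true] at h2 ⊢
    simp only [h2]
    split_ifs <;> simp
  · simp [hs]

/-- Faces of the Koszul complex lie in the nonzero blocks. -/
theorem lt_of_mem_KosQ {F : Finset ℕ}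
    (hF : F ∈ KosQ K n I fun i => if b i < s then d (b i) else 0) {j : ℕ} (hj : j ∈ F) :
    j < n ∧ b j < s := by
  have hjn := Finset.mem_range.1 (hF.1 hj)
  refine ⟨hjn, ?_⟩
  have := hF.2.1 ⟨j, hjn⟩ hj
  by_contra h
  simp [h] at this

theorem mem_KosQ_iff (hI : IsSymmetricIdeal K n I) (hn : n = cumsum p (s + 1))
    (hdpos : ∀ k < s, 0 < d k) (hbs : ∀ j < n, b j ≤ s)
    (hb : ∀ k ≤ s, ((Finset.range n).filter fun j => b j = k).card = p k)
    {F : Finset ℕ} (hF : ∀ j ∈ F, j < n ∧ b j < s) {C : ℕ → ℕ} (hCp : ∀ k < s, C k ≤ p k)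
    (hC : ∀ k < s, (F.filter fun j => b j = k).card = C k) :
    F ∈ KosQ K n I (fun i => if b i < s then d (b i) else 0) ↔
      mon K n (fun i => muMinus s d p C i) ∉ I := by
  rw [← mon_sub_mem_iff (d := d) hI hn hbs hb hF hCp hC]
  refine ⟨fun h => h.2.2, fun h => ⟨fun j hj => Finset.mem_range.2 (hF j hj).1, fun i hi => ?_, h⟩⟩
  simp only [if_pos (hF i hi).2]
  exact hdpos _ (hF i hi).2

theorem faceConvex_KosQ (a : Fin n → ℕ) : FaceConvex (KosQ K n I a) := by
  intro F hF u _ v _ _ h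
  refine ⟨(Finset.erase_subset _ _).trans hF.1,
    fun i hi => hF.2.1 i (Finset.mem_of_mem_erase hi), fun hm => h.2.2 (mon_mem_of_le ?_ hm)⟩
  intro i
  refine Nat.sub_le_sub_left ?_ _
  simp only [eF]
  split_ifs with h1 h2
  · exact le_rfl
  · exact absurd (Finset.mem_of_mem_erase h1) h2
  · exact Nat.zero_le _
  · exact le_rfl

theorem swap_mem_KosQ_iff (hI : IsSymmetricIdeal K n I) {a : Fin n → ℕ} {u v : Fin n}
    (ha : a u = a v) {F : Finset ℕ} (hv : (v : ℕ) ∈ F) (hu : (u : ℕ) ∉ F) :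
    insert (u : ℕ) (F.erase v) ∈ KosQ K n I a ↔ F ∈ KosQ K n I a := by
  have huv : u ≠ v := fun h => hu (h ▸ hv)
  have hσ : ∀ i, a (Equiv.swap u v i) = a i := fun i => by
    rw [Equiv.swap_apply_def]
    split_ifs with h1 h2
    · rw [h1, ha]
    · rw [h2, ha]
    · rfl
  have hF : ∀ i : Fin n, (i : ℕ) ∈ insert (u : ℕ) (F.erase v) ↔
      ((Equiv.swap u v i : Fin n) : ℕ) ∈ F := fun i => by
    rw [Equiv.swap_apply_def, Finset.mem_insert, Finset.mem_erase, Fin.val_inj, Ne, Fin.val_inj]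
    split_ifs with h1 h2
    · simp [h1, hv]
    · simp [h2, hu, huv.symm]
    · simp [h1, h2]
  have h1 : insert (u : ℕ) (F.erase v) ⊆ Finset.range n ↔ F ⊆ Finset.range n := by
    rw [Finset.insert_subset_iff]
    refine ⟨fun h j hj => ?_, fun h =>
      ⟨Finset.mem_range.2 u.2, (Finset.erase_subset _ _).trans h⟩⟩
    by_cases hjv : j = v
    · exact hjv ▸ Finset.mem_range.2 v.2
    · exact h.2 (Finset.mem_erase.2 ⟨hjv, hj⟩)
  have h2 : (∀ i : Fin n, (i : ℕ) ∈ insert (u : ℕ) (F.erase v) → 1 ≤ a i) ↔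
      ∀ i : Fin n, (i : ℕ) ∈ F → 1 ≤ a i := by
    rw [← (Equiv.swap u v).forall_congr_right (q := fun i : Fin n => (i : ℕ) ∈ F → 1 ≤ a i)]
    simp only [hF, hσ]
  have h3 : (fun i => a i - eF (insert (u : ℕ) (F.erase v)) i) =
      (fun i : Fin n => a i - eF F i) ∘ Equiv.swap u v := by
    funext i
    simp only [Function.comp_apply, hσ, eF, hF]
  simp only [KosQ, Set.mem_ofPred_eq]
  rw [h1, h2, h3, mon_comp_mem_iff hI]

end Rearrangement

theorem card_image_comp_perm {α β : Type} [Fintype α] [Fintype β] [DecidableEq α]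
    [DecidableEq β] (f : α → β) :
    (Finset.univ.image fun σ : Equiv.Perm α => f ∘ σ).card *
      ∏ y, (Finset.univ.filter fun a => f a = y).card.factorial =
        (Fintype.card α).factorial := by
  have hstab := DomMulAct.stabilizer_card f
  simp only [Fintype.card_subtype] at hstab
  have hfib : ∀ a ∈ Finset.univ.image (fun σ : Equiv.Perm α => f ∘ σ),
      (Finset.univ.filter fun σ : Equiv.Perm α => f ∘ σ = a).card =
        ∏ y, (Finset.univ.filter fun a => f a = y).card.factorial := by
    intro a ha
    obtain ⟨τ, -, rfl⟩ := Finset.mem_image.1 ha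
    rw [← hstab]
    refine Finset.card_bij' (fun σ _ => σ * τ⁻¹) (fun σ _ => σ * τ) ?_ ?_ ?_ ?_
    · intro σ hσ
      rw [Finset.mem_filter] at hσ ⊢
      refine ⟨Finset.mem_univ _, ?_⟩
      rw [Equiv.Perm.coe_mul, ← Function.comp_assoc, hσ.2, Function.comp_assoc,
        ← Equiv.Perm.coe_mul, mul_inv_cancel, Equiv.Perm.coe_one, Function.comp_id]
    · intro σ hσ
      rw [Finset.mem_filter] at hσ ⊢
      refine ⟨Finset.mem_univ _, ?_⟩
      rw [Equiv.Perm.coe_mul, ← Function.comp_assoc, hσ.2]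
    · intro σ _
      simp
    · intro σ _
      simp
  rw [← Fintype.card_perm, ← Finset.card_univ,
    Finset.card_eq_sum_card_image (fun σ : Equiv.Perm α => f ∘ σ), Finset.sum_congr rfl hfib,
    Finset.sum_const, smul_eq_mul]

section Counting

variable {s : ℕ} {b q : ℕ → ℕ} {U : Finset ℕ}

/-- The subsets of a union of blocks with prescribed intersection numbers with the blocks. -/
theorem card_filter_powerset_eq_prod (hU : ∀ j ∈ U, b j < s) (c : ℕ → ℕ) :
    (U.powerset.filter fun E => ∀ k < s, (E.filter fun j => b j = k).card = c k).card =
      ∏ k ∈ Finset.range s, ((U.filter fun j => b j = k).card).choose (c k) := by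
  rw [← Fin.prod_univ_eq_prod_range
    (fun k => ((U.filter fun j => b j = k).card).choose (c k)) s]
  simp only [← Finset.card_powersetCard]
  rw [← Fintype.card_piFinset]
  refine Finset.card_bij' (fun E _ k => E.filter fun j => b j = k)
    (fun f _ => Finset.univ.biUnion f) ?_ ?_ ?_ ?_
  · intro E hE
    rw [Finset.mem_filter, Finset.mem_powerset] at hE
    rw [Fintype.mem_piFinset]
    exact fun k => Finset.mem_powersetCard.2
      ⟨Finset.filter_subset_filter _ hE.1, hE.2 k k.2⟩
  · intro f hf
    rw [Fintype.mem_piFinset] at hf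
    simp only [Finset.mem_powersetCard] at hf
    rw [Finset.mem_filter, Finset.mem_powerset]
    refine ⟨Finset.biUnion_subset.2 fun k _ => (hf k).1.trans (Finset.filter_subset _ _),
      fun k hk => ?_⟩
    rw [← (hf ⟨k, hk⟩).2]
    congr 1
    ext j
    simp only [Finset.mem_filter, Finset.mem_biUnion, Finset.mem_univ, true_and]
    refine ⟨fun ⟨⟨l, hl⟩, h⟩ => ?_, fun h => ⟨⟨_, h⟩, (Finset.mem_filter.1 ((hf _).1 h)).2⟩⟩
    obtain rfl : l = ⟨k, hk⟩ := Fin.ext ((Finset.mem_filter.1 ((hf l).1 hl)).2.symm.trans h)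
    exact hl
  · intro E hE
    rw [Finset.mem_filter, Finset.mem_powerset] at hE
    ext j
    simp only [Finset.mem_filter, Finset.mem_biUnion, Finset.mem_univ, true_and]
    exact ⟨fun ⟨_, h, _⟩ => h, fun h => ⟨⟨b j, hU j (hE.1 h)⟩, h, rfl⟩⟩
  · intro f hf
    rw [Fintype.mem_piFinset] at hf
    simp only [Finset.mem_powersetCard] at hf
    funext k
    ext j
    simp only [Finset.mem_filter, Finset.mem_biUnion, Finset.mem_univ, true_and]
    refine ⟨fun ⟨⟨l, hl⟩, h⟩ => ?_, fun h => ⟨⟨_, h⟩, (Finset.mem_filter.1 ((hf _).1 h)).2⟩⟩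
    obtain rfl : l = k := Fin.ext ((Finset.mem_filter.1 ((hf l).1 hl)).2.symm.trans h)
    exact hl

/-- A sum over the subsets of a union of blocks, grouped by the sizes of the intersections with the
blocks. -/
theorem sum_powerset_eq_sum_pi {p : ℕ → ℕ} (hU : ∀ j ∈ U, b j < s)
    (hp : ∀ k < s, (U.filter fun j => b j = k).card < p k) {g : Finset ℕ → ℕ}
    {G : ((k : Fin s) → Fin (p k)) → ℕ}
    (hG : ∀ E ⊆ U, ∀ c, (∀ k < s, (E.filter fun j => b j = k).card = cExt s p c k) → g E = G c) :
    ∑ E ∈ U.powerset, g E = ∑ c : (k : Fin s) → Fin (p k),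
      (∏ k ∈ Finset.range s, ((U.filter fun j => b j = k).card).choose (cExt s p c k)) * G c := by
  let cnt : Finset ℕ → (k : Fin s) → Fin (p k) := fun E k =>
    ⟨(E.filter fun j => b j = k).card % p k, Nat.mod_lt _ (Nat.zero_lt_of_lt (hp k k.2))⟩
  rw [← Finset.sum_fiberwise _ cnt]
  refine Finset.sum_congr rfl fun c _ => ?_
  have hcnt : U.powerset.filter (fun E => cnt E = c) =
      U.powerset.filter fun E => ∀ k < s, (E.filter fun j => b j = k).card = cExt s p c k := by
    refine Finset.filter_congr fun E hE => ?_
    rw [funext_iff, Fin.forall_iff]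
    refine forall₂_congr fun k hk => ?_
    have : (E.filter fun j => b j = k).card < p k :=
      (Finset.card_le_card (Finset.filter_subset_filter _ (Finset.mem_powerset.1 hE))).trans_lt
        (hp k hk)
    simp only [cnt, Fin.ext_iff, cExt, dif_pos hk, Nat.mod_eq_of_lt this]
  rw [hcnt, ← card_filter_powerset_eq_prod hU, ← smul_eq_mul, ← Finset.sum_const]
  refine Finset.sum_congr rfl fun E hE => ?_
  rw [Finset.mem_filter, Finset.mem_powerset] at hE
  exact hG E hE.1 c hE.2

end Counting

section Main

variable {K : Type} [Field K] {n s : ℕ} {d p b : ℕ → ℕ} {I : Ideal (MvPolynomial (Fin n) K)}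

theorem card_filter_coFace {q : ℕ → ℕ} {E H : Finset ℕ} (hqb : ∀ k < s, b (q k) = k)
    (hE : Disjoint E ((Finset.range s).image q)) {k : ℕ} (hk : k < s) :
    ((coFace s q E H).filter fun j => b j = k).card =
      (E.filter fun j => b j = k).card + if k < s ∧ k ∉ H then 1 else 0 := by
  have h1 : (((Finset.range s \ H).image q).filter fun j => b j = k) =
      if k < s ∧ k ∉ H then {q k} else ∅ := by
    ext j
    simp only [Finset.mem_filter, Finset.mem_image, Finset.mem_sdiff, Finset.mem_range]
    split_ifs with h
    · rw [Finset.mem_singleton]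
      constructor
      · rintro ⟨⟨l, hl, rfl⟩, h2⟩
        rw [hqb l hl.1] at h2
        rw [h2]
      · rintro rfl
        exact ⟨⟨k, h, rfl⟩, hqb k hk⟩
    · refine iff_of_false ?_ (Finset.notMem_empty j)
      rintro ⟨⟨l, hl, rfl⟩, h2⟩
      rw [hqb l hl.1] at h2
      exact h (h2 ▸ hl)
  rw [coFace, Finset.filter_union, Finset.card_union_of_disjoint, h1]
  · split_ifs <;> rfl
  · exact Finset.disjoint_filter_filter (hE.mono_right (Finset.image_subset_image
      Finset.sdiff_subset))

/-- The Betti numbers of `R/I` in a single multidegree. -/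
theorem torQDim_eq_sum (hI : IsSymmetricIdeal K n I) (hn : n = cumsum p (s + 1))
    (hdpos : ∀ k < s, 0 < d k) (hppos : ∀ k < s, 0 < p k) (hbs : ∀ j < n, b j ≤ s)
    (hb : ∀ k ≤ s, ((Finset.range n).filter fun j => b j = k).card = p k) (i : ℕ) :
    torQDim K n I i (fun t => if b t < s then d (b t) else 0) =
      ∑ c : (k : Fin s) → Fin (p k),
        (∏ k ∈ Finset.range s, Nat.choose (p k - 1) (cExt s p c k)) *
          hdim0 K (GammaCx K n I s d p (cExt s p c))
            ((s : ℤ) - i - 1 + ∑ k ∈ Finset.range s, (cExt s p c k : ℤ)) := by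
  have hex : ∀ k, ∃ j, k < s → j < n ∧ b j = k := by
    intro k
    by_cases hk : k < s
    · have := hppos k hk
      rw [← hb k hk.le, Finset.card_pos] at this
      obtain ⟨j, hj⟩ := this
      rw [Finset.mem_filter, Finset.mem_range] at hj
      exact ⟨j, fun _ => hj⟩
    · exact ⟨0, fun h => absurd h hk⟩
  choose q hq using hex
  have hqb : ∀ k < s, b (q k) = k := fun k hk => (hq k hk).2
  have hqinj : Set.InjOn q (Finset.range s) := by
    intro k hk l hl h
    rw [Finset.mem_coe, Finset.mem_range] at hk hl
    rw [← hqb k hk, h, hqb l hl]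
  set W := (Finset.range n).filter fun j => b j < s with hW
  set Q := (Finset.range s).image q with hQ
  have hWmem : ∀ {j}, j ∈ W ↔ j < n ∧ b j < s := by simp [hW]
  have hQW : Q ⊆ W := by
    intro j hj
    obtain ⟨k, hk, rfl⟩ := Finset.mem_image.1 hj
    rw [Finset.mem_range] at hk
    exact hWmem.2 ⟨(hq k hk).1, (hqb k hk).symm ▸ hk⟩
  have hblock : ∀ k < s, ((W \ Q).filter fun j => b j = k).card = p k - 1 := by
    intro k hk
    have : (W \ Q).filter (fun j => b j = k) =
        ((Finset.range n).filter fun j => b j = k).erase (q k) := by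
      ext j
      simp only [Finset.mem_filter, Finset.mem_sdiff, hWmem, Finset.mem_erase, Finset.mem_range, hQ,
        Finset.mem_image, not_exists, not_and]
      constructor
      · rintro ⟨⟨h1, h2⟩, rfl⟩
        exact ⟨fun h => h2 (b j) hk h.symm, h1.1, rfl⟩
      · rintro ⟨h1, h2, rfl⟩
        exact ⟨⟨⟨h2, hk⟩, fun l hl h => h1 (by rw [← h, hqb l hl])⟩, rfl⟩
    rw [this, Finset.card_erase_of_mem, hb k hk.le]
    exact Finset.mem_filter.2 ⟨Finset.mem_range.2 (hq k hk).1, hqb k hk⟩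
  rw [torQDim, rhd0_eq_sum_coLink (W := W)
    (fun F hF j hj => hWmem.2 (lt_of_mem_KosQ hF hj)) (faceConvex_KosQ _) hqinj hQW]
  · have hlt : ∀ j ∈ W \ Q, b j < s := fun j hj => (hWmem.1 (Finset.mem_sdiff.1 hj).1).2
    have hle : ∀ k < s, ((W \ Q).filter fun j => b j = k).card < p k := fun k hk => by
      have := hppos k hk
      rw [hblock k hk]
      omega
    rw [sum_powerset_eq_sum_pi hlt hle
      (G := fun c => hdim0 K (GammaCx K n I s d p (cExt s p c))
            ((s : ℤ) - i - 1 + ∑ k ∈ Finset.range s, (cExt s p c k : ℤ)))]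
    · refine Finset.sum_congr rfl fun c _ => ?_
      congr 1
      refine Finset.prod_congr rfl fun k hk => ?_
      rw [hblock k (Finset.mem_range.1 hk)]
    · intro E hE c hc
      have hEQ : Disjoint E Q := Finset.disjoint_of_subset_left hE Finset.sdiff_disjoint
      have hcp : ∀ k < s, cExt s p c k < p k := fun k hk => by
        rw [cExt, dif_pos hk]
        exact (c ⟨k, hk⟩).2
      have hcard : (E.card : ℤ) = ∑ k ∈ Finset.range s, (cExt s p c k : ℤ) := by
        rw [Finset.card_eq_sum_card_fiberwise (f := b) (t := Finset.range s)
          fun j hj => Finset.mem_coe.2 (Finset.mem_range.2 (hlt j (hE hj)))]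
        push_cast
        exact Finset.sum_congr rfl fun k hk => by rw [hc k (Finset.mem_range.1 hk)]
      rw [hcard]
      congr 1
      ext H
      refine and_congr_right fun hH => ?_
      refine mem_KosQ_iff hI hn hdpos hbs hb ?_ ?_ ?_
      · intro j hj
        rcases Finset.mem_union.1 hj with hj | hj
        · exact hWmem.1 (Finset.mem_sdiff.1 (hE hj)).1
        · exact hWmem.1 (hQW (Finset.image_subset_image Finset.sdiff_subset hj))
      · intro k hk
        have := hcp k hk
        split_ifs <;> omega
      · intro k hk
        rw [card_filter_coFace hqb hEQ hk, hc k hk]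
  · intro v hv
    obtain ⟨hvn, hvs⟩ := hWmem.1 (Finset.mem_sdiff.1 hv).1
    refine ⟨q (b v), Finset.mem_image_of_mem q (Finset.mem_range.2 hvs), fun F hvF huF => ?_⟩
    exact swap_mem_KosQ_iff hI (u := ⟨q (b v), (hq _ hvs).1⟩) (v := ⟨v, hvn⟩)
      (by simp only [hqb _ hvs]) hvF huF

/-- The number of rearrangements of a partition. -/
theorem card_image_muOf (hn : n = cumsum p (s + 1)) (hd : ∀ k, k + 1 < s → d (k + 1) < d k)
    (hdpos : ∀ k < s, 0 < d k) :
    (Finset.univ.image fun σ : Equiv.Perm (Fin n) =>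
      (fun t : Fin n => muOf s d p t) ∘ σ).card =
        n.factorial / ∏ k ∈ Finset.range (s + 1), (p k).factorial := by
  let D : Fin (s + 1) → ℕ := fun k => if (k : ℕ) < s then d k else 0
  let f : Fin n → Fin (s + 1) := fun t => ⟨blkOf p s t, Nat.lt_succ_of_le (blkOf_le p s t)⟩
  have hD : StrictAnti D := by
    refine Fin.strictAnti_iff_succ_lt.2 fun k => ?_
    simp only [D, Fin.val_succ, Fin.val_castSucc, if_pos k.2]
    split_ifs with h
    · exact hd k h
    · exact hdpos k k.2
  have himg : (Finset.univ.image fun σ : Equiv.Perm (Fin n) =>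
      (fun t : Fin n => muOf s d p t) ∘ σ) =
      (Finset.univ.image fun σ : Equiv.Perm (Fin n) => f ∘ σ).image fun g => D ∘ g := by
    rw [Finset.image_image]
    rfl
  rw [himg, Finset.card_image_of_injective _ hD.injective.comp_left]
  have h := card_image_comp_perm f
  have hprod : ∏ y, (Finset.univ.filter fun a => f a = y).card.factorial =
      ∏ k ∈ Finset.range (s + 1), (p k).factorial := by
    rw [← Fin.prod_univ_eq_prod_range fun k => (p k).factorial]
    refine Finset.prod_congr rfl fun k _ => ?_
    simp only [f, Fin.ext_iff]
    rw [card_filter_fin n fun j => blkOf p s j = k, hn, card_filter_blkOf (Nat.le_of_lt_succ k.2)]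
  rw [hprod, Fintype.card_fin] at h
  rw [← h, Nat.mul_div_cancel _ (Finset.prod_pos fun k _ => Nat.factorial_pos _)]

end Main

/-- equivariant Hochster formula for `R/I`, via Alexander duality.
For an `S_n`-invariant monomial ideal `I` and
`μ = (d_1^{p_1}, …, d_s^{p_s}, 0^{p_{s+1}}) ∈ P_n` with `d_1 > ⋯ > d_s > 0`:
`dim_k Tor_i(R/I,k)_{⟨μ⟩}
  = Σ_{0 ≤ c ≤ p(μ)} D(c) · dim_k H̃_{s-i-1+|c|}(Γ^{μ,c}(I); k)`, where
`D(c) = (n!/(p_1! ⋯ p_s! p_{s+1}!)) · Π_k C(p_k - 1, c_k)`. -/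
theorem statement_1 (K : Type) [Field K] (n s : ℕ) (d p : ℕ → ℕ)
    (hn : n = cumsum p (s + 1))
    (hd : ∀ k, k + 1 < s → d (k + 1) < d k)
    (hdpos : ∀ k, k < s → 0 < d k)
    (hppos : ∀ k, k < s → 0 < p k)
    (I : Ideal (MvPolynomial (Fin n) K))
    (hmon : IsMonomialIdeal K n I) (hsym : IsSymmetricIdeal K n I)
    (i : ℕ) :
    torQDimSym K n I i (fun t => muOf s d p t.val) =
      ∑ c : (k : Fin s) → Fin (p k),
        ((n.factorial / ∏ k ∈ Finset.range (s + 1), (p k).factorial) *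
            ∏ k ∈ Finset.range s, Nat.choose (p k - 1) (cExt s p c k)) *
          hdim0 K (GammaCx K n I s d p (cExt s p c))
            ((s : ℤ) - i - 1 + ∑ k ∈ Finset.range s, (cExt s p c k : ℤ)) := by
  rw [torQDimSym, Finset.sum_congr rfl (g := fun _ => ∑ c : (k : Fin s) → Fin (p k),
    (∏ k ∈ Finset.range s, Nat.choose (p k - 1) (cExt s p c k)) *
      hdim0 K (GammaCx K n I s d p (cExt s p c))
        ((s : ℤ) - i - 1 + ∑ k ∈ Finset.range s, (cExt s p c k : ℤ)))]
  · rw [Finset.sum_const, card_image_muOf hn hd hdpos, smul_eq_mul, Finset.mul_sum]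
    simp only [mul_assoc]
  · intro a ha
    obtain ⟨σ, -, rfl⟩ := Finset.mem_image.1 ha
    let b : ℕ → ℕ := fun j => if h : j < n then blkOf p s (σ ⟨j, h⟩) else s
    have hb : ∀ t : Fin n, b t = blkOf p s (σ t) := fun t => dif_pos t.2
    have hcount : ∀ k ≤ s, ((Finset.range n).filter fun j => b j = k).card = p k := by
      intro k hk
      refine Eq.trans ?_ (card_filter_blkOf hk)
      rw [← hn, ← card_filter_fin, ← card_filter_fin]
      simp only [hb]
      exact Finset.card_equiv σ (by simp)
    rw [← torQDim_eq_sum (b := b) hsym hn hdpos hppos (fun j hj => ?_) hcount]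
    · simp only [hb]
      rfl
    · simp only [b, dif_pos hj, blkOf_le]
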